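/- arXiv:2103.11605 — 3 statements merged into one kernel-verified Lean document; each statement's English description precedes it below -/
import Mathlib

section
/- Let p ≥ 1, c ≥ 1 be integers and b = pc + 1. Let 0 = s_0 < s_1 < ⋯ < s_k < n and set s_{k+1} := n. Then the probability that the set of d-descents of the (b,n,p)-shuffle equals {s_1,…,s_k} is P(s_1,…,s_k) = b^{−n} · det( f(i,j) )_{i,j = 0,…,k}, where f(i,j) = binom(s_{j+1} − s_i + b − 1, b − 1) for 0 ≤ i ≤ k and 0 ≤ j ≤ k−1, and f(i,k) = binom(n − s_i + c, c) for 0 ≤ i ≤ k. -/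
open scoped Classical

noncomputable section

/-- Binomial coefficient with integer top, taken to be `0` when the top is negative
(so in particular `zchoose a r = 0` whenever `a < r`). -/
def zchoose (a : ℤ) (r : ℕ) : ℕ := if 0 ≤ a then a.toNat.choose r else 0

/-- Rank of a color `r ∈ Z_p` in the order `0, p-1, p-2, …, 1` used to define
the linear order on `Σ = {1,…,n} × Z_p`. -/
def rho (p : ℕ) (r : ZMod p) : ℕ := if r = 0 then 0 else p - r.val

/-- The linear order on `Σ`: `(i,r) < (j,s)` iff the color of `r` comes strictly earlier
(in the order `0, p-1, …, 1`), or the colors agree and `i < j`. -/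
def sigmaLt (p : ℕ) (x y : ℕ × ZMod p) : Prop :=
  rho p x.2 < rho p y.2 ∨ (rho p x.2 = rho p y.2 ∧ x.1 < y.1)

/-- The position part of the `(b,n,p)`-shuffle determined by labels `A`:
`σ(i) = #{j : A j < A i, or A j = A i and j ≤ i}`. -/
def shufflePos {n b : ℕ} (A : Fin n → Fin b) (i : Fin n) : ℕ :=
  (Finset.univ.filter fun j : Fin n => A j < A i ∨ (A j = A i ∧ j ≤ i)).card

/-- The color part of the `(b,n,p)`-shuffle determined by labels `A`: `σ_c(i) = A i mod p`. -/
def shuffleCol (p : ℕ) {n b : ℕ} (A : Fin n → Fin b) (i : Fin n) : ZMod p :=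
  ((A i : ℕ) : ZMod p)

/-- The pair `(σ(i), σ_c(i))` of the `(b,n,p)`-shuffle determined by labels `A`. -/
def shufflePair (p : ℕ) {n b : ℕ} (A : Fin n → Fin b) (i : Fin n) : ℕ × ZMod p :=
  (shufflePos A i, shuffleCol p A i)

/-- The shuffle `π[A]` has a d-descent at position `i+1` (positions are `1,…,n`):
for positions `< n` this means `(σ(i),σ_c(i)) > (σ(i+1),σ_c(i+1))`,
and at position `n` it means `σ_c(n) ≠ 0`. -/
def shuffleHasDDescentAt (p : ℕ) {n b : ℕ} (A : Fin n → Fin b) (i : Fin n) : Prop :=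
  if h : (i : ℕ) + 1 < n then
    sigmaLt p (shufflePair p A ⟨(i : ℕ) + 1, h⟩) (shufflePair p A i)
  else shuffleCol p A i ≠ 0

/-- The set of d-descent positions (a subset of `{1,…,n}`) of the shuffle `π[A]`. -/
def shuffleDDescentSet (p : ℕ) {n b : ℕ} (A : Fin n → Fin b) : Finset ℕ :=
  (Finset.univ.filter fun i : Fin n => shuffleHasDDescentAt p A i).image fun i => (i : ℕ) + 1

lemma det_hess (k : ℕ) (f : ℕ → ℕ → ℝ) (N : ℕ → ℝ) (hN : N (k+1) = 1)
    (h1 : ∀ j, j < k → f (j+1) j = 1) (h0 : ∀ i j, i ≤ k → j + 1 < i → f i j = 0)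
    (hrec : ∀ i, i ≤ k → (-1:ℝ)^i * N i = ∑ j ∈ Finset.Ico i (k+1), (-1:ℝ)^j * f i j * N (j+1)) :
    (Matrix.of fun i j : Fin (k+1) => f i j).det = N 0 := by
  set M : Matrix (Fin (k+1)) (Fin (k+1)) ℝ := Matrix.of fun i j : Fin (k+1) => f i j with hM
  have hd := Matrix.det_updateCol_sum M (Fin.last k) (fun j => (-1:ℝ)^(j:ℕ) * N (j+1))
  have hcol : (fun i : Fin (k+1) => ∑ j : Fin (k+1), ((-1:ℝ)^(j:ℕ) * N (j+1)) • M i j)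
      = fun i => if i = 0 then N 0 else 0 := by
    funext i
    have e1 : ∑ j : Fin (k+1), ((-1:ℝ)^(j:ℕ) * N (j+1)) • M i j
        = ∑ j ∈ Finset.range (k+1), (-1:ℝ)^j * f i j * N (j+1) := by
      rw [Finset.sum_range]
      refine Finset.sum_congr rfl fun j _ => ?_
      simp [hM]; ring
    rw [e1]
    have hi : (i:ℕ) ≤ k := by omega
    rw [← Finset.sum_range_add_sum_Ico _ (show (i:ℕ) ≤ k+1 by omega), ← hrec i hi]
    by_cases h : i = 0
    · subst h; simp
    · rw [if_neg h]
      obtain ⟨m, hm⟩ : ∃ m, (i:ℕ) = m + 1 := ⟨i - 1, by have := Fin.pos_iff_ne_zero.2 h; have : 0 < (i:ℕ) := this; omega⟩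
      rw [hm, Finset.sum_range_succ, Finset.sum_eq_zero, h1 m (by omega)]
      · ring
      · intro j hj
        rw [h0 _ _ (by omega) (by have := Finset.mem_range.1 hj; omega)]; ring
  rw [hcol] at hd
  rw [Matrix.det_succ_column _ (Fin.last k)] at hd
  rw [Finset.sum_eq_single 0] at hd
  · have htri : ((M.updateCol (Fin.last k) fun i => if i = 0 then N 0 else 0).submatrix
        (Fin.succAbove 0) (Fin.succAbove (Fin.last k))).det = 1 := by
      rw [Matrix.det_of_isUpperTriangular]
      · refine Finset.prod_eq_one fun i _ => ?_
        simp [Matrix.updateCol_apply, hM, Fin.castSucc_ne_last]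
        exact h1 i i.2
      · intro i j hij
        have hij : (j:ℕ) < i := hij
        simp [Matrix.updateCol_apply, hM, Fin.castSucc_ne_last]
        exact h0 _ _ (by omega) (by omega)
    rw [htri] at hd
    simp [hN] at hd
    exact hd.symm
  · intro i _ hi
    simp [hi]
  · simp

lemma sum_choose_aux (b c m x : ℕ) (hc : c < b) :
    ∑ z ∈ Finset.range b, (if x ≤ z then (if z ≤ c then ((m + (c - z)).choose m : ℝ) else 0) else 0)
     = if x ≤ c then ((m + 1 + (c - x)).choose (m+1) : ℝ) else 0 := by
  by_cases hx : x ≤ c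
  · rw [if_pos hx]
    obtain ⟨d, rfl⟩ := Nat.exists_eq_add_of_le hx
    clear hx
    induction d generalizing x with
    | zero =>
      rw [Finset.sum_eq_single x]
      · simp
      · intro z _ hz
        split_ifs <;> first | rfl | omega
      · intro h; simp at h; omega
    | succ d ih =>
      have h2 := ih (x+1) (by omega)
      rw [show x + (d+1) = x+1+d by ring]
      have h3 : ∀ z ∈ Finset.range b, (if x ≤ z then (if z ≤ x+1+d then ((m + (x+1+d - z)).choose m : ℝ) else 0) else 0)
        = (if x = z then ((m + (d+1)).choose m : ℝ) else 0) + (if x+1 ≤ z then (if z ≤ x+1+d then ((m + (x+1+d - z)).choose m : ℝ) else 0) else 0) := by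
        intro z _
        by_cases h : x = z
        · subst h; simp [show x ≤ x+1+d by omega, show x + 1 + d - x = d+1 by omega]
        · have : (x ≤ z) ↔ (x + 1 ≤ z) := by omega
          simp [h, this]
      rw [Finset.sum_congr rfl h3, Finset.sum_add_distrib, h2, Finset.sum_ite_eq, if_pos (by simp; omega)]
      rw [show x+1+d-(x+1) = d by omega, show x + 1 + d - x = d+1 by omega]
      rw [show m + 1 + (d+1) = (m + (d+1)) + 1 by ring, Nat.choose_succ_succ]
      push_cast
      rw [show m + 1 + d = m + (d+1) by ring]
  · rw [if_neg hx]
    refine Finset.sum_eq_zero fun z _ => ?_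
    split_ifs <;> first | rfl | omega

def hvec {b : ℕ} (r : Fin b → Fin b) (c m : ℕ) : Fin b → ℝ :=
  fun x => if (r x : ℕ) ≤ c then ((m + (c - r x)).choose m : ℝ) else 0

def Umat {b : ℕ} (r : Fin b → Fin b) : Matrix (Fin b) (Fin b) ℝ :=
  Matrix.of fun x y => if r x ≤ r y then 1 else 0

lemma Umat_hvec {b : ℕ} (r : Fin b → Fin b) (hr : Function.Bijective r) (c m : ℕ) (hc : c < b) :
    (Umat r).mulVec (hvec r c m) = hvec r c (m+1) := by
  funext x
  have := sum_choose_aux b c m (r x) hc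
  rw [Finset.sum_range] at this
  rw [hvec, ← this, ← (Equiv.ofBijective r hr).sum_comp]
  simp only [Matrix.mulVec, dotProduct, Umat, hvec, Matrix.of_apply, Equiv.ofBijective_apply, ite_mul, one_mul, zero_mul, Fin.le_def]

lemma sum_hvec {b : ℕ} (r : Fin b → Fin b) (hr : Function.Bijective r) (c m : ℕ) (hc : c < b) :
    ∑ x, hvec r c m x = ((m + 1 + c).choose (m+1) : ℝ) := by
  have := sum_choose_aux b c m 0 hc
  rw [Finset.sum_range] at this
  simp at this
  rw [← this, ← (Equiv.ofBijective r hr).sum_comp (fun x : Fin b => if (x:ℕ) ≤ c then ((m + (c - x)).choose m : ℝ) else 0)]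
  simp [hvec]

lemma transfer {b : ℕ} (K : ℕ → Matrix (Fin b) (Fin b) ℝ) (v : ℕ → Fin b → ℝ) (m : ℕ)
    (hv : ∀ t, t < m → v t = (K t).mulVec (v (t+1))) :
    ∑ A : Fin (m+1) → Fin b, (∏ i : Fin m, K i (A i.castSucc) (A i.succ)) * v m (A (Fin.last m))
      = ∑ x, v 0 x := by
  induction m with
  | zero =>
    simp
    exact (Equiv.funUnique (Fin 1) (Fin b)).sum_comp (fun x => v 0 x)
  | succ m ih =>
    rw [← ih (fun t ht => hv t (by omega))]
    rw [← (Fin.snocEquiv (fun _ : Fin (m+2) => Fin b)).sum_comp, Fintype.sum_prod_type, Finset.sum_comm]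
    refine Finset.sum_congr rfl fun A _ => ?_
    rw [hv m (by omega)]
    simp only [Matrix.mulVec, dotProduct, Finset.mul_sum]
    refine Finset.sum_congr rfl fun x _ => ?_
    rw [Fin.prod_univ_castSucc]
    have e1 : ∀ i : Fin (m+1), (Fin.snocEquiv (fun _ : Fin (m+2) => Fin b)) (x, A) i.castSucc = A i := by
      intro i; simp [Fin.snocEquiv]
    have e2 : (Fin.snocEquiv (fun _ : Fin (m+2) => Fin b)) (x, A) (Fin.last (m+1)) = x := by
      simp [Fin.snocEquiv]
    simp only [e1, e2, Fin.succ_castSucc, Fin.succ_last, Fin.val_castSucc, Fin.val_last, mul_assoc]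

def Lmat {b : ℕ} (r : Fin b → Fin b) : Matrix (Fin b) (Fin b) ℝ :=
  Matrix.of fun x y => if r y < r x then 1 else 0

lemma Lmat_mulVec {b : ℕ} (r : Fin b → Fin b) (v : Fin b → ℝ) :
    (Lmat r).mulVec v = (∑ x, v x) • hvec r (b-1) 0 - (Umat r).mulVec v := by
  funext x
  have : ((r x : ℕ)) ≤ b - 1 := by omega
  simp only [Matrix.mulVec, dotProduct, Lmat, Umat, hvec, Matrix.of_apply, Pi.sub_apply, Pi.smul_apply, this, if_true, smul_eq_mul]
  simp only [zero_add, Nat.choose_zero_right, Nat.cast_one, mul_one]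
  rw [← Finset.sum_sub_distrib]
  refine Finset.sum_congr rfl fun y _ => ?_
  by_cases h : r x ≤ r y
  · simp [h, not_lt.2 h]
  · simp [h, not_le.1 h]

lemma vform {b : ℕ} (r : Fin b → Fin b) (hr : Function.Bijective r) (c m k : ℕ) (hc : c < b)
    (s : ℕ → ℕ) (hs : ∀ i j, i < j → j ≤ k + 1 → s i < s j) (hlast : s (k+1) = m+1)
    (S : Finset ℕ) (hS : S = (Finset.Icc 1 k).image s)
    (v : ℕ → Fin b → ℝ)
    (hv : ∀ t, t < m → v t = (if t + 1 ∈ S then Lmat r else Umat r).mulVec (v (t+1)))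
    (hm : v m = hvec r c 0) (d : ℕ) : ∀ t i, t + d = m → i ≤ k → s i ≤ t → t < s (i+1) →
    (-1:ℝ)^i • v t = ∑ j ∈ Finset.Ico i k,
        ((-1:ℝ)^j * ∑ x, v (s (j+1)) x) • hvec r (b-1) (s (j+1) - t - 1)
      + (-1:ℝ)^k • hvec r c (m - t) := by
  induction d with
  | zero =>
    intro t i ht hi h1 h2
    have : i = k := by
      by_contra hne
      have := hs (i+1) (k+1) (by omega) le_rfl
      omega
    subst this
    have : t = m := by omega
    subst this
    simp [hm]
  | succ d ih =>
    intro t i ht hi h1 h2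
    by_cases hlt : t + 1 < s (i+1)
    · have hn : t + 1 ∉ S := by
        rw [hS]
        intro h
        obtain ⟨j, hj, hj2⟩ := Finset.mem_image.1 h
        have hj := Finset.mem_Icc.1 hj
        rcases lt_trichotomy j (i+1) with h | h | h
        · rcases Nat.lt_or_ge j i with h' | h'
          · have := hs j i h' (by omega); omega
          · have : j = i := by omega
            subst this; omega
        · subst h; omega
        · have := hs (i+1) j h (by omega); omega
      have := ih (t+1) i (by omega) hi (by omega) hlt
      rw [hv t (by omega), if_neg hn, ← Matrix.mulVec_smul, this, Matrix.mulVec_add, Matrix.mulVec_sum,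
        Matrix.mulVec_smul, Umat_hvec r hr _ _ hc, show m - (t+1) + 1 = m - t by omega]
      congr 1
      refine Finset.sum_congr rfl fun j hj => ?_
      have hj := Finset.mem_Ico.1 hj
      have : s (i+1) ≤ s (j+1) := by
        rcases Nat.eq_or_lt_of_le hj.1 with h | h
        · subst h; rfl
        · exact (hs _ _ (by omega) (by omega)).le
      rw [Matrix.mulVec_smul, Umat_hvec r hr _ _ (by omega), show s (j+1) - (t+1) - 1 + 1 = s (j+1) - t - 1 by omega]
    · have heq : s (i+1) = t + 1 := by omega
      have hik : i < k := by
        by_contra h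
        have : i = k := by omega
        subst this; omega
      have hn : t + 1 ∈ S := by
        rw [hS]
        exact Finset.mem_image.2 ⟨i+1, Finset.mem_Icc.2 ⟨by omega, by omega⟩, heq⟩
      have hlt2 := hs (i+1) (i+2) (by omega) (by omega)
      have := ih (t+1) (i+1) (by omega) (by omega) (by omega) (by show _ < s (i+2); omega)
      have key : (-1:ℝ)^i • v t = ((-1:ℝ)^i * ∑ x, v (s (i+1)) x) • hvec r (b-1) 0
          + (Umat r).mulVec ((-1:ℝ)^(i+1) • v (t+1)) := by
        rw [hv t (by omega), if_pos hn, Lmat_mulVec, Matrix.mulVec_smul, heq, smul_sub, pow_succ, smul_smul]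
        simp [sub_eq_add_neg]
      rw [key, this, Matrix.mulVec_add, Matrix.mulVec_sum,
        Matrix.mulVec_smul, Umat_hvec r hr _ _ hc, show m - (t+1) + 1 = m - t by omega,
        Finset.sum_eq_sum_Ico_succ_bot hik, heq, show t + 1 - t - 1 = 0 by omega, add_assoc]
      congr 2
      refine Finset.sum_congr rfl fun j hj => ?_
      have hj := Finset.mem_Ico.1 hj
      have : s (i+1) < s (j+1) := (hs _ _ (by omega) (by omega))
      rw [Matrix.mulVec_smul, Umat_hvec r hr _ _ (by omega), show s (j+1) - (t+1) - 1 + 1 = s (j+1) - t - 1 by omega]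

def rankFn (p c a : ℕ) : ℕ := if a % p = 0 then a / p else 1 + (p - a % p) * c + a / p

lemma rankFn_lt (p c a : ℕ) (hp : 1 ≤ p) (ha : a < p * c + 1) : rankFn p c a < p * c + 1 := by
  have h1 := Nat.div_add_mod a p
  have h2 := Nat.mod_lt a hp
  unfold rankFn
  split_ifs with h
  · have : a / p ≤ a := Nat.div_le_self _ _
    omega
  · have h3 : a / p < c := by
      by_contra h3
      have : p * c ≤ p * (a / p) := Nat.mul_le_mul_left _ (by omega)
      omega
    have h4 : (p - a % p) * c ≤ (p - 1) * c := Nat.mul_le_mul_right _ (by omega)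
    have h5 : (p - 1) * c + c = p * c := by
      obtain ⟨q, rfl⟩ := Nat.exists_eq_add_of_le hp
      simp; ring
    omega

def rk (p a : ℕ) : ℕ := if a % p = 0 then 0 else p - a % p

lemma rho_cast (p a : ℕ) (hp : 1 ≤ p) : rho p ((a : ℕ) : ZMod p) = rk p a := by
  unfold rho rk
  haveI : NeZero p := ⟨by omega⟩
  rw [ZMod.val_natCast]
  congr 1
  rw [ZMod.natCast_eq_zero_iff]
  exact propext (Nat.dvd_iff_mod_eq_zero ..)

lemma rankFn_le_iff (p c a : ℕ) (hp : 1 ≤ p) (ha : a < p * c + 1) : rankFn p c a ≤ c ↔ a % p = 0 := by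
  have h2 := Nat.mod_lt a hp
  unfold rankFn
  split_ifs with h
  · simp only [h, iff_true]
    exact Nat.div_le_of_le_mul (by omega)
  · simp only [h, iff_false]
    have : 1 * c ≤ (p - a % p) * c := Nat.mul_le_mul_right _ (by omega)
    have := Nat.zero_le (a / p)
    generalize a / p = q at *
    generalize (p - a % p) * c = q' at *
    omega

lemma rankFn_lt_of (p c a a' : ℕ) (hp : 1 ≤ p) (ha : a < p * c + 1) (ha' : a' < p * c + 1)
    (h : rk p a < rk p a' ∨ (rk p a = rk p a' ∧ a < a')) : rankFn p c a < rankFn p c a' := by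
  have h1 := Nat.div_add_mod a p
  have h2 := Nat.mod_lt a hp
  have h1' := Nat.div_add_mod a' p
  have h2' := Nat.mod_lt a' hp
  rcases h with h | ⟨h, hlt⟩
  · by_cases h0' : a' % p = 0
    · simp [rk, h0'] at h
    by_cases h0 : a % p = 0
    · have := (rankFn_le_iff p c a hp ha).2 h0
      have := mt (rankFn_le_iff p c a' hp ha').1 h0'
      omega
    · have h3 : a / p < c := by
        by_contra h3
        have : p * c ≤ p * (a / p) := Nat.mul_le_mul_left _ (by omega)
        omega
      simp only [rk, rankFn, h0, h0', if_false] at h ⊢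
      have : (p - a % p + 1) * c ≤ (p - a' % p) * c := Nat.mul_le_mul_right _ (by omega)
      rw [add_mul] at this
      have := Nat.zero_le (a' / p)
      generalize a' / p = q at *
      generalize a / p = q' at *
      omega
  · have hmod : a % p = a' % p := by
      unfold rk at h
      split_ifs at h <;> omega
    have hdiv : a / p < a' / p := by
      by_contra h3
      have : p * (a' / p) ≤ p * (a / p) := Nat.mul_le_mul_left _ (by omega)
      omega
    unfold rankFn
    rw [hmod]
    split_ifs <;> omega

lemma rankFn_lt_iff (p c a a' : ℕ) (hp : 1 ≤ p) (ha : a < p * c + 1) (ha' : a' < p * c + 1) :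
    rankFn p c a < rankFn p c a' ↔ (rk p a < rk p a' ∨ (rk p a = rk p a' ∧ a < a')) := by
  refine ⟨fun h => ?_, rankFn_lt_of p c a a' hp ha ha'⟩
  by_contra hcon
  by_cases he : a = a'
  · subst he; omega
  · have := rankFn_lt_of p c a' a hp ha' ha (by omega)
    omega

def rfun (p c b : ℕ) (hp : 1 ≤ p) (hb : b = p * c + 1) (x : Fin b) : Fin b :=
  ⟨rankFn p c x, by have := rankFn_lt p c x hp (by omega); omega⟩

lemma rfun_bij (p c b : ℕ) (hp : 1 ≤ p) (hb : b = p * c + 1) : Function.Bijective (rfun p c b hp hb) := by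
  apply Finite.injective_iff_bijective.1
  intro x y hxy
  have hxy : rankFn p c x = rankFn p c y := congrArg Fin.val hxy
  by_contra hne
  have hne : (x:ℕ) ≠ y := fun h => hne (Fin.ext h)
  have h1 := rankFn_lt_iff p c x y hp (by omega) (by omega)
  have h2 := rankFn_lt_iff p c y x hp (by omega) (by omega)
  omega

lemma shufflePos_lt {n b : ℕ} (A : Fin n → Fin b) (i j : Fin n) (h : A j < A i) :
    shufflePos A j < shufflePos A i := by
  unfold shufflePos
  apply Finset.card_lt_card
  rw [Finset.ssubset_iff_of_subset]
  · refine ⟨i, by simp, ?_⟩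
    simp [not_lt.2 h.le, h.ne']
  · intro l
    simp only [Finset.mem_filter, Finset.mem_univ, true_and]
    rintro (h1 | ⟨h1, _⟩)
    · exact Or.inl (h1.trans h)
    · exact Or.inl (h1 ▸ h)

lemma shufflePos_le {n b : ℕ} (A : Fin n → Fin b) (i j : Fin n) (h : A i = A j) (hij : i ≤ j) :
    shufflePos A i ≤ shufflePos A j := by
  unfold shufflePos
  apply Finset.card_le_card
  intro l
  simp only [Finset.mem_filter, Finset.mem_univ, true_and, h]
  rintro (h1 | ⟨h1, h2⟩)
  · exact Or.inl h1
  · exact Or.inr ⟨h1, h2.trans hij⟩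

lemma desc_iff (p c b : ℕ) (hp : 1 ≤ p) (hb : b = p * c + 1) {n : ℕ} (A : Fin n → Fin b) (i j : Fin n)
    (hij : i ≤ j) : sigmaLt p (shufflePair p A j) (shufflePair p A i) ↔
      rfun p c b hp hb (A j) < rfun p c b hp hb (A i) := by
  have := rankFn_lt_iff p c (A j) (A i) hp (by omega) (by omega)
  show _ ↔ rankFn p c (A j) < rankFn p c (A i)
  rw [this]
  simp only [sigmaLt, shufflePair, shuffleCol, rho_cast p _ hp]
  have : shufflePos A j < shufflePos A i ↔ A j < A i := by
    refine ⟨fun h => ?_, shufflePos_lt A i j⟩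
    by_contra hcon
    rcases (not_lt.1 hcon).lt_or_eq with h' | h'
    · have := shufflePos_lt A j i h'; omega
    · have := shufflePos_le A i j h' hij; omega
  rw [this, Fin.lt_def]

lemma descSet_iff (p c b : ℕ) (hp : 1 ≤ p) (hb : b = p * c + 1) (m : ℕ) (A : Fin (m+1) → Fin b)
    (S : Finset ℕ) (hS : ∀ t ∈ S, 1 ≤ t ∧ t ≤ m) :
    shuffleDDescentSet p A = S ↔
      (∀ i : Fin m, rfun p c b hp hb (A i.succ) < rfun p c b hp hb (A i.castSucc) ↔ (i:ℕ) + 1 ∈ S) ∧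
      (rfun p c b hp hb (A (Fin.last m)) : ℕ) ≤ c := by
  have hmem0 : ∀ t : ℕ, t ∈ shuffleDDescentSet p A ↔
      ∃ i : Fin (m+1), shuffleHasDDescentAt p A i ∧ (i:ℕ) + 1 = t := by
    intro t
    simp [shuffleDDescentSet, Finset.bind_def, Finset.pure_def]
  have hmem : ∀ i : Fin (m+1), (i:ℕ) + 1 ∈ shuffleDDescentSet p A ↔ shuffleHasDDescentAt p A i := by
    intro i
    rw [hmem0]
    constructor
    · rintro ⟨j, hj, hji⟩
      have : j = i := Fin.ext (by omega)
      exact this ▸ hj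
    · intro h; exact ⟨i, h, rfl⟩
  have hd : ∀ i : Fin m, shuffleHasDDescentAt p A i.castSucc ↔
      rfun p c b hp hb (A i.succ) < rfun p c b hp hb (A i.castSucc) := by
    intro i
    rw [← desc_iff p c b hp hb A i.castSucc i.succ (Fin.castSucc_lt_succ).le]
    unfold shuffleHasDDescentAt
    rw [dif_pos (by simp)]
    rfl
  have hl : shuffleHasDDescentAt p A (Fin.last m) ↔ ¬ (rfun p c b hp hb (A (Fin.last m)) : ℕ) ≤ c := by
    unfold shuffleHasDDescentAt
    rw [dif_neg (by simp)]
    show _ ↔ ¬ rankFn p c _ ≤ c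
    rw [rankFn_le_iff p c _ hp (by omega)]
    simp only [shuffleCol, ne_eq, ZMod.natCast_eq_zero_iff, Nat.dvd_iff_mod_eq_zero]
  constructor
  · intro h
    refine ⟨fun i => ?_, ?_⟩
    · rw [← hd, ← hmem, h]; rfl
    · by_contra hcon
      rw [← hl, ← hmem, h] at hcon
      have := hS _ hcon
      simp at this
  · rintro ⟨h1, h2⟩
    ext t
    constructor
    · intro ht
      obtain ⟨i, hi, rfl⟩ := (hmem0 t).1 ht
      induction i using Fin.lastCases with
      | last => exact absurd h2 (hl.1 hi)
      | cast i => exact (h1 i).1 ((hd i).1 hi)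
    · intro ht
      have := hS t ht
      obtain ⟨q, rfl⟩ := Nat.exists_eq_add_of_le' this.1
      have := (hmem (Fin.castSucc ⟨q, by omega⟩)).2 ((hd _).2 ((h1 _).2 ht))
      exact this

lemma indic {b m : ℕ} (r : Fin b → Fin b) (c : ℕ) (S : Finset ℕ) (A : Fin (m+1) → Fin b) :
    (∏ i : Fin m, (if (i:ℕ) + 1 ∈ S then Lmat r else Umat r) (A i.castSucc) (A i.succ)) *
      hvec r c 0 (A (Fin.last m)) =
    if ((∀ i : Fin m, r (A i.succ) < r (A i.castSucc) ↔ (i:ℕ) + 1 ∈ S) ∧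
      (r (A (Fin.last m)) : ℕ) ≤ c) then 1 else 0 := by
  have : ∀ i : Fin m, (if (i:ℕ) + 1 ∈ S then Lmat r else Umat r) (A i.castSucc) (A i.succ)
      = if (r (A i.succ) < r (A i.castSucc) ↔ (i:ℕ) + 1 ∈ S) then 1 else 0 := by
    intro i
    by_cases h : (i:ℕ) + 1 ∈ S
    · simp [h, Lmat]
    · simp [h, Umat]
  simp only [this, Fintype.prod_ite_zero, hvec]
  by_cases h : (∀ i : Fin m, r (A i.succ) < r (A i.castSucc) ↔ (i:ℕ) + 1 ∈ S) <;>
  by_cases h' : (r (A (Fin.last m)) : ℕ) ≤ c <;> simp [h, h']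

/-- **Theorem (determinantal formula for the `(b,n,p)`-shuffle, case `s_k < n`).**
For `b = pc + 1` and `0 = s_0 < s_1 < ⋯ < s_k < n`, `s_{k+1} := n`, the probability that
the d-descent set of the `(b,n,p)`-shuffle equals `{s_1,…,s_k}` is
`b⁻ⁿ · det(f(i,j))` with `f(i,j) = binom(s_{j+1} - s_i + b - 1, b-1)` for `j < k` and
`f(i,k) = binom(n - s_i + c, c)`. -/
theorem statement0 (p c n k : ℕ) (hp : 1 ≤ p) (hc : 1 ≤ c) (hn : 1 ≤ n)
    (b : ℕ) (hb : b = p * c + 1)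
    (s : ℕ → ℕ) (hs0 : s 0 = 0) (hmono : ∀ i, i ≤ k → s i < s (i + 1))
    (hlast : s (k + 1) = n) :
    ((Finset.univ.filter fun A : Fin n → Fin b =>
        shuffleDDescentSet p A = (Finset.Icc 1 k).image s).card : ℝ) / (b : ℝ) ^ n
      = ((b : ℝ) ^ n)⁻¹ *
        (Matrix.of fun i j : Fin (k + 1) =>
          if (j : ℕ) = k then (zchoose ((n : ℤ) - s (i : ℕ) + c) c : ℝ)
          else (zchoose ((s ((j : ℕ) + 1) : ℤ) - s (i : ℕ) + b - 1) (b - 1) : ℝ)).det := by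
  obtain ⟨m, rfl⟩ := Nat.exists_eq_add_of_le' hn
  have hs : ∀ j, ∀ i, i < j → j ≤ k + 1 → s i < s j := by
    intro j
    induction j with
    | zero => intro i h; omega
    | succ j ih =>
      intro i h1 h2
      have h3 := hmono j (by omega)
      rcases Nat.lt_succ_iff_lt_or_eq.1 h1 with h | h
      · exact (ih i h (by omega)).trans h3
      · exact h ▸ h3
  have hs : ∀ i j, i < j → j ≤ k + 1 → s i < s j := fun i j => hs j i
  set S : Finset ℕ := (Finset.Icc 1 k).image s with hSdef
  have hS : ∀ t ∈ S, 1 ≤ t ∧ t ≤ m := by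
    intro t ht
    obtain ⟨j, hj, rfl⟩ := Finset.mem_image.1 ht
    have hj := Finset.mem_Icc.1 hj
    have h1 := hs 0 j (by omega) (by omega)
    have h2 := hs j (k+1) (by omega) (by omega)
    omega
  have hcb : c < b := by
    have := Nat.mul_le_mul_right c hp
    omega
  set r := rfun p c b hp hb with hrdef
  have hr : Function.Bijective r := rfun_bij p c b hp hb
  let K : ℕ → Matrix (Fin b) (Fin b) ℝ := fun t => if t + 1 ∈ S then Lmat r else Umat r
  let u : ℕ → Fin b → ℝ := fun d => Nat.rec (hvec r c 0) (fun d w => (K (m - (d+1))).mulVec w) d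
  let v : ℕ → Fin b → ℝ := fun t => u (m - t)
  have hvm : v m = hvec r c 0 := by
    show u (m - m) = _
    rw [Nat.sub_self]
    rfl
  have hv : ∀ t, t < m → v t = (K t).mulVec (v (t+1)) := by
    intro t ht
    show u (m - t) = (K t).mulVec (u (m - (t+1)))
    obtain ⟨d, hd⟩ : ∃ d, m - t = d + 1 := ⟨m - t - 1, by omega⟩
    rw [hd, show m - (t+1) = d by omega]
    show (K (m - (d+1))).mulVec (u d) = _
    rw [show m - (d+1) = t by omega]
  have hcount : ((Finset.univ.filter fun A : Fin (m+1) → Fin b =>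
        shuffleDDescentSet p A = S).card : ℝ) = ∑ x, v 0 x := by
    rw [← transfer K v m hv, hvm, Finset.card_filter]
    push_cast
    refine Finset.sum_congr rfl fun A _ => ?_
    rw [indic r c S A]
    simp only [descSet_iff p c b hp hb m A S hS]
    rfl
  have hform := vform r hr c m k hcb s hs hlast S hSdef v hv hvm
  have hdet := det_hess k (fun i j => if j = k then (zchoose (((m+1:ℕ) : ℤ) - s i + c) c : ℝ)
          else (zchoose ((s (j + 1) : ℤ) - s i + b - 1) (b - 1) : ℝ))
      (fun i => if i = k + 1 then 1 else ∑ x, v (s i) x) (by simp) ?_ ?_ ?_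
  · rw [hcount]
    simp only [hs0, Nat.zero_ne_add_one, if_false, show (0:ℕ) ≠ k + 1 by omega] at hdet
    rw [← hdet, div_eq_inv_mul]
  · intro j hj
    simp only [hj.ne, if_false, sub_self]
    rw [show (0:ℤ) + b - 1 = ((b-1 : ℕ) : ℤ) by omega]
    simp [zchoose]
  · intro i j hi hj
    rw [if_neg (by omega)]
    have := hs (j+1) i hj (by omega)
    unfold zchoose
    split_ifs with h
    · rw [Nat.choose_eq_zero_of_lt (by omega)]; simp
    · simp
  · intro i hi
    have hi1 := hs i (i+1) (by omega) (by omega)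
    have hik := hs i (k+1) (by omega) (by omega)
    have h := hform (m - s i) (s i) i (by omega) hi le_rfl hi1
    have h := congrArg (fun w : Fin b → ℝ => ∑ x, w x) h
    simp only [Pi.add_apply, Pi.smul_apply, smul_eq_mul, Finset.sum_add_distrib, ← Finset.mul_sum,
      Finset.sum_apply] at h
    rw [Finset.sum_comm] at h
    simp only [← Finset.mul_sum] at h
    rw [if_neg (by omega), h, Finset.sum_Ico_succ_top hi]
    congr 1
    · refine Finset.sum_congr rfl fun j hj => ?_
      have hj := Finset.mem_Ico.1 hj
      have hij := hs i (j+1) (by omega) (by omega)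
      rw [if_neg (by omega), if_neg (by omega), sum_hvec r hr _ _ (by omega)]
      have : ((s (j+1) : ℤ) - s i + b - 1) = ((s (j+1) - s i - 1 + 1 + (b-1) : ℕ) : ℤ) := by omega
      rw [this, zchoose, if_pos (by omega), Int.toNat_natCast, Nat.choose_symm_add]
      ring
    · rw [if_pos rfl, if_pos rfl, sum_hvec r hr _ _ hcb]
      have : (((m+1:ℕ) : ℤ) - s i + c) = ((m - s i + 1 + c : ℕ) : ℤ) := by omega
      rw [this, zchoose, if_pos (by omega), Int.toNat_natCast, Nat.choose_symm_add]
      ring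
end
end

section
/- Let p ≥ 1 and let σ be chosen uniformly at random from G_{p,n}. Let 0 = s_0 < s_1 < ⋯ < s_{k−1} < s_k = n. Then the probability that the set of d-descents of σ equals {s_1,…,s_{k−1},n} is det( g(i,j) )_{i,j = 0,…,k−1}, where g(i,j) = 1/(s_{j+1} − s_i)! for 0 ≤ i ≤ k−1 and 0 ≤ j ≤ k−2, and g(i,k−1) = (1 − (1/p)^{n − s_i}) / (n − s_i)! for 0 ≤ i ≤ k−1. -/
open scoped Classical

noncomputable section

/-- `1/m!` for an integer `m`, taken to be `0` for negative `m`. -/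
def invFact (m : ℤ) : ℝ := if 0 ≤ m then ((m.toNat).factorial : ℝ)⁻¹ else 0

/-- The dash order on `Σ`: `(i,r) <′ (j,s)` iff `r < s` (colors in the order `0,1,…,p-1`),
or `r = s` and `i < j`. -/
def sigmaLt' {p : ℕ} (x y : ℕ × ZMod p) : Prop :=
  x.2.val < y.2.val ∨ (x.2 = y.2 ∧ x.1 < y.1)

/-- An element of `G_{p,n}`, given by its permutation part and its colors;
`σ` is determined by the pairs `(σ(i), σ_c(i))`. -/
abbrev ColoredPerm (p n : ℕ) := Equiv.Perm (Fin n) × (Fin n → ZMod p)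

/-- The pair `(σ(i), σ_c(i)) ∈ {1,…,n} × Z_p`. -/
def cpPair {p n : ℕ} (σ : ColoredPerm p n) (i : Fin n) : ℕ × ZMod p :=
  ((σ.1 i : ℕ) + 1, σ.2 i)

/-- `σ ∈ G_{p,n}` has a d-descent at position `i+1` (positions are `1,…,n`):
for positions `< n` this means `(σ(i),σ_c(i)) > (σ(i+1),σ_c(i+1))`,
and at position `n` it means `σ_c(n) ≠ 0`. -/
def cpHasDDescentAt {p n : ℕ} (σ : ColoredPerm p n) (i : Fin n) : Prop :=
  if h : (i : ℕ) + 1 < n then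
    sigmaLt p (cpPair σ ⟨(i : ℕ) + 1, h⟩) (cpPair σ i)
  else σ.2 i ≠ 0

/-- The set of d-descent positions (a subset of `{1,…,n}`) of `σ ∈ G_{p,n}`. -/
def cpDDescentSet {p n : ℕ} (σ : ColoredPerm p n) : Finset ℕ :=
  (Finset.univ.filter fun i : Fin n => cpHasDDescentAt σ i).image fun i => (i : ℕ) + 1

/-- `σ ∈ G_{p,n}` has a d′-descent at position `i+1` (positions are `1,…,n`):
for positions `< n` this means `(σ(i),σ_c(i)) >′ (σ(i+1),σ_c(i+1))`,
and at position `n` it means `σ_c(n) = p - 1`. -/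
def cpHasD'DescentAt {p n : ℕ} (σ : ColoredPerm p n) (i : Fin n) : Prop :=
  if h : (i : ℕ) + 1 < n then
    sigmaLt' (cpPair σ ⟨(i : ℕ) + 1, h⟩) (cpPair σ i)
  else σ.2 i = ((p - 1 : ℕ) : ZMod p)

/-- The set of d′-descent positions (a subset of `{1,…,n}`) of `σ ∈ G_{p,n}`. -/
def cpD'DescentSet {p n : ℕ} (σ : ColoredPerm p n) : Finset ℕ :=
  (Finset.univ.filter fun i : Fin n => cpHasD'DescentAt σ i).image fun i => (i : ℕ) + 1


def dkey {p n : ℕ} (σ : ColoredPerm p n) (i : Fin n) : ℕ ×ₗ ℕ :=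
  toLex (rho p (σ.2 i), (σ.1 i : ℕ))

lemma dkey_inj {p n : ℕ} (σ : ColoredPerm p n) : Function.Injective (dkey σ) := by
  intro i j h
  have h1 : (σ.1 i : ℕ) = (σ.1 j : ℕ) := congrArg (fun z => (ofLex z).2) h
  exact σ.1.injective (Fin.ext h1)

lemma sigmaLt_iff {p n : ℕ} (σ : ColoredPerm p n) (i j : Fin n) :
    sigmaLt p (cpPair σ i) (cpPair σ j) ↔ dkey σ i < dkey σ j := by
  simp [sigmaLt, cpPair, dkey, Prod.Lex.toLex_lt_toLex]

lemma rho_zero_iff {p : ℕ} [NeZero p] (r : ZMod p) : rho p r = 0 ↔ r = 0 := by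
  unfold rho
  have := ZMod.val_lt r
  split_ifs with h
  · simp [h]
  · simp [h]; omega

lemma mem_desc {p n : ℕ} (σ : ColoredPerm p n) (t : ℕ) :
    t ∈ cpDDescentSet σ ↔ ∃ i : Fin n, cpHasDDescentAt σ i ∧ (i : ℕ) + 1 = t := by
  unfold cpDDescentSet
  simp

lemma mem_lt {p n : ℕ} (σ : ColoredPerm p n) (x : ℕ) (h : x + 1 < n) :
    x + 1 ∈ cpDDescentSet σ ↔ dkey σ ⟨x + 1, h⟩ < dkey σ ⟨x, by omega⟩ := by
  rw [mem_desc]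
  rw [← sigmaLt_iff]
  constructor
  · rintro ⟨i, hi, hx⟩
    have : i = ⟨x, Nat.lt_of_succ_lt h⟩ := Fin.ext (by simpa using hx)
    subst this
    simpa [cpHasDDescentAt, h] using hi
  · intro hi
    exact ⟨⟨x, by omega⟩, by simpa [cpHasDDescentAt, h] using hi, rfl⟩

lemma mem_last {p n : ℕ} (σ : ColoredPerm p n) (x : ℕ) (h : x + 1 = n) :
    x + 1 ∈ cpDDescentSet σ ↔ σ.2 ⟨x, by omega⟩ ≠ 0 := by
  rw [mem_desc]
  constructor
  · rintro ⟨i, hi, hx⟩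
    have : i = ⟨x, h ▸ Nat.lt_succ_self x⟩ := Fin.ext (by simpa using hx)
    subst this
    simpa [cpHasDDescentAt, h] using hi
  · intro hi
    exact ⟨⟨x, by omega⟩, by simpa [cpHasDDescentAt, h] using hi, rfl⟩

lemma mem_range {p n : ℕ} (σ : ColoredPerm p n) (t : ℕ) (h : t ∈ cpDDescentSet σ) :
    0 < t ∧ t ≤ n := by
  rw [mem_desc] at h
  obtain ⟨i, -, rfl⟩ := h
  have := i.2
  omega

def ascOn {p n : ℕ} (a b : ℕ) (σ : ColoredPerm p n) : Prop :=
  ∀ t, a < t → t < b → t ∉ cpDDescentSet σ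

lemma ascOn_le {p n : ℕ} {a b : ℕ} (hb : b ≤ n) {σ : ColoredPerm p n} (h : ascOn a b σ)
    (x : ℕ) (hx : a ≤ x) (d : ℕ) (hd : x + d < b) :
    dkey σ ⟨x, by omega⟩ ≤ dkey σ ⟨x + d, by omega⟩ := by
  induction d with
  | zero => exact le_refl _
  | succ d ih =>
    refine (ih (by omega)).trans ?_
    have := h (x + d + 1) (by omega) (by omega)
    rw [mem_lt σ (x + d) (by omega)] at this
    exact not_lt.mp this

def blk (n a b : ℕ) (hb : b ≤ n) : Fin (b - a) ↪ Fin n :=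
  ⟨fun i => ⟨a + i, by omega⟩, fun i j h => by
    have := congrArg Fin.val h
    simp at this
    exact Fin.ext this⟩

lemma ascOn_iff {p n : ℕ} {a b : ℕ} (hb : b ≤ n) (σ : ColoredPerm p n) :
    ascOn a b σ ↔ Monotone (dkey σ ∘ blk n a b hb) := by
  constructor
  · intro h i j hij
    have hij' : (i : ℕ) ≤ j := hij
    have := ascOn_le hb h (a + i) (by omega) (j - i) (by omega)
    have e : (⟨a + i + (j - i), by omega⟩ : Fin n) = blk n a b hb j := by
      apply Fin.ext
      show a + (i : ℕ) + (j - i) = a + j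
      omega
    rw [e] at this
    exact this
  · intro h t h1 h2
    obtain ⟨x, rfl⟩ : ∃ x, t = x + 1 := ⟨t - 1, by omega⟩
    rw [mem_lt σ x (by omega), not_lt]
    have := @h ⟨x - a, by omega⟩ ⟨x + 1 - a, by omega⟩ (by simp [Fin.le_def]; omega)
    have e1 : (⟨x, by omega⟩ : Fin n) = blk n a b hb ⟨x - a, by omega⟩ := by
      apply Fin.ext
      show x = a + (x - a)
      omega
    have e2 : (⟨x + 1, by omega⟩ : Fin n) = blk n a b hb ⟨x + 1 - a, by omega⟩ := by
      apply Fin.ext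
      show x + 1 = a + (x + 1 - a)
      omega
    rw [e1, e2]
    exact this

def actE (p n : ℕ) (τ : Equiv.Perm (Fin n)) : ColoredPerm p n ≃ ColoredPerm p n where
  toFun σ := (σ.1 * τ, σ.2 ∘ τ)
  invFun σ := (σ.1 * τ⁻¹, σ.2 ∘ (τ⁻¹ : Equiv.Perm (Fin n)))
  left_inv σ := by ext <;> simp
  right_inv σ := by ext <;> simp

lemma dkey_act {p n : ℕ} (τ : Equiv.Perm (Fin n)) (σ : ColoredPerm p n) (x : Fin n) :
    dkey (actE p n τ σ) x = dkey σ (τ x) := rfl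

lemma blockCount {p n : ℕ} [NeZero p] {a b : ℕ} (hb : b ≤ n) (Q : ColoredPerm p n → Prop)
    (hQ : ∀ τ : Equiv.Perm (Fin n), (∀ x : Fin n, ¬ (a ≤ (x : ℕ) ∧ (x : ℕ) < b) → τ x = x) →
      ∀ σ, Q (actE p n τ σ) ↔ Q σ) :
    (Finset.univ.filter fun σ => Q σ ∧ ascOn a b σ).card * (b - a).factorial
      = (Finset.univ.filter Q).card := by
  let E : Equiv.Perm (Fin (b - a)) → (ColoredPerm p n ≃ ColoredPerm p n) :=
    fun τ => actE p n (τ.viaEmbedding (blk n a b hb))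
  have hE : ∀ τ σ, Q (E τ σ) ↔ Q σ := by
    intro τ σ
    apply hQ
    intro x hx
    apply Equiv.Perm.viaEmbedding_apply_of_notMem
    rintro ⟨i, rfl⟩
    apply hx
    show a ≤ a + (i : ℕ) ∧ a + (i : ℕ) < b
    omega
  have hA : ∀ τ σ, ascOn a b (E τ σ) ↔ Monotone ((dkey σ ∘ blk n a b hb) ∘ τ) := by
    intro τ σ
    rw [ascOn_iff hb]
    have : dkey (E τ σ) ∘ blk n a b hb = (dkey σ ∘ blk n a b hb) ∘ τ := by
      funext i
      simp [E, dkey_act, Equiv.Perm.viaEmbedding_apply]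
    rw [this]
  have h1 : ∀ τ, (Finset.univ.filter fun σ => Q σ ∧ ascOn a b (E τ σ)).card
      = (Finset.univ.filter fun σ => Q σ ∧ ascOn a b σ).card := by
    intro τ
    apply Finset.card_equiv (E τ)
    intro σ
    simp [hE]
  have h2 : ∀ σ, (Finset.univ.filter fun τ => ascOn a b (E τ σ)).card = 1 := by
    intro σ
    rw [Finset.card_eq_one]
    refine ⟨Tuple.sort (dkey σ ∘ blk n a b hb), ?_⟩
    ext τ
    simp only [Finset.mem_filter, Finset.mem_univ, true_and, Finset.mem_singleton, hA]
    constructor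
    · intro h
      have := Tuple.unique_monotone h (Tuple.monotone_sort (dkey σ ∘ blk n a b hb))
      ext i
      have h3 := congrFun this i
      have := ((dkey_inj σ).comp (blk n a b hb).injective) h3
      rw [this]
    · rintro rfl
      exact Tuple.monotone_sort _
  have h3 : ∑ τ : Equiv.Perm (Fin (b - a)),
      (Finset.univ.filter fun σ => Q σ ∧ ascOn a b (E τ σ)).card = (Finset.univ.filter Q).card := by
    simp only [Finset.card_filter]
    rw [Finset.sum_comm]
    apply Finset.sum_congr rfl
    intro σ _
    by_cases hq : Q σ
    · have := h2 σ
      rw [Finset.card_filter] at this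
      simp [hq, this]
    · simp [hq]
  rw [← h3, Finset.sum_congr rfl (fun τ _ => h1 τ)]
  simp [Fintype.card_perm, mul_comm]

def zeroOn {p n : ℕ} (a : ℕ) (σ : ColoredPerm p n) : Prop :=
  ∀ x : Fin n, a ≤ (x : ℕ) → σ.2 x = 0

def trv {p n : ℕ} (_ : ColoredPerm p n) : Prop := True

lemma zeroCount {p n : ℕ} [NeZero p] {a : ℕ} (ha : a ≤ n) :
    (Finset.univ.filter fun σ : ColoredPerm p n => zeroOn a σ).card
      = n.factorial * p ^ a := by
  have : (Finset.univ.filter fun σ : ColoredPerm p n => zeroOn a σ)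
      = (Finset.univ : Finset (Equiv.Perm (Fin n))) ×ˢ
        Fintype.piFinset (fun x : Fin n => if a ≤ (x : ℕ) then {(0 : ZMod p)} else Finset.univ) := by
    ext σ
    simp only [Finset.mem_filter, Finset.mem_univ, true_and, Finset.mem_product,
      Fintype.mem_piFinset]
    unfold zeroOn
    apply forall_congr'
    intro x
    split_ifs with h <;> simp [h]
  rw [this, Finset.card_product, Fintype.card_piFinset]
  congr 1
  · simp [Fintype.card_perm]
  · have : ∀ x : Fin n, (if a ≤ (x : ℕ) then {(0 : ZMod p)} else Finset.univ).card
        = if (x : ℕ) < a then p else 1 := by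
      intro x
      by_cases h : a ≤ (x : ℕ)
      · simp [h, not_lt.mpr h]
      · simp [h, not_le.mp h, ZMod.card]
    rw [Finset.prod_congr rfl (fun x _ => this x), Finset.prod_ite]
    simp only [Finset.prod_const, one_pow, mul_one, Fin.card_filter_val_lt, min_eq_right ha]

def hessM (g : ℕ → ℕ → ℝ) (a i m : ℕ) : Matrix (Fin (m + 1)) (Fin (m + 1)) ℝ :=
  Matrix.of fun x y => if (x : ℕ) = 0 then g a (i + y) else g (i + x) (i + y)

lemma hess_rec (g : ℕ → ℕ → ℝ) (a i m : ℕ) (h1 : g (i + 1) i = 1)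
    (h0 : ∀ x, 2 ≤ x → x ≤ m + 1 → g (i + x) i = 0) :
    (hessM g a i (m + 1)).det
      = g a i * (hessM g (i + 1) (i + 1) m).det - (hessM g a (i + 1) m).det := by
  rw [Matrix.det_succ_column_zero, Fin.sum_univ_succ, Fin.sum_univ_succ, Finset.sum_eq_zero]
  · have e1 : (hessM g a i (m + 1)).submatrix (Fin.succAbove 0) Fin.succ
        = hessM g (i + 1) (i + 1) m := by
      ext x y
      refine Fin.cases ?_ (fun x => ?_) x
      · simp [hessM]; congr 1; omega
      · simp [hessM]; congr 1 <;> omega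
    have e2 : (hessM g a i (m + 1)).submatrix (Fin.succAbove (Fin.succ 0)) Fin.succ
        = hessM g a (i + 1) m := by
      ext x y
      refine Fin.cases ?_ (fun x => ?_) x
      · simp [hessM]; congr 1; omega
      · have : (Fin.succ (0 : Fin (m + 1))).succAbove x.succ = x.succ.succ := by
          rw [Fin.succ_succAbove_succ, Fin.succAbove_zero]
        rw [Matrix.submatrix_apply, this]
        simp [hessM]; congr 1 <;> omega
    rw [e1, e2]
    simp [hessM, h1]
    ring
  · intro x _
    have : hessM g a i (m + 1) x.succ.succ 0 = 0 := by
      simp [hessM]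
      exact h0 _ (by omega) (by omega)
    rw [this]; simp

def evt {p n : ℕ} (k : ℕ) (s : ℕ → ℕ) (a i : ℕ) (σ : ColoredPerm p n) : Prop :=
  ∀ t, s a < t → t ≤ n → (t ∈ cpDDescentSet σ ↔ ∃ j, i < j ∧ j ≤ k ∧ t = s j)

lemma invFact_sub {a b : ℕ} (h : a ≤ b) : invFact ((b : ℤ) - a) = ((b - a).factorial : ℝ)⁻¹ := by
  unfold invFact
  rw [if_pos (by omega)]
  congr 3
  omega

section main
variable {p n k : ℕ} [NeZero p] {s : ℕ → ℕ}

lemma s_mono (hmono : ∀ i, i < k → s i < s (i + 1)) {i j : ℕ} (hij : i < j) (hj : j ≤ k) :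
    s i < s j := by
  induction j with
  | zero => omega
  | succ j ih =>
    rcases Nat.lt_succ_iff_lt_or_eq.mp hij with h | rfl
    · exact (ih h (by omega)).trans (hmono j (by omega))
    · exact hmono i (by omega)

lemma evt_inv (i : ℕ) (b : ℕ) (τ : Equiv.Perm (Fin n))
    (hτ : ∀ x : Fin n, ¬ (b ≤ (x : ℕ) ∧ (x : ℕ) < s i) → τ x = x) (σ : ColoredPerm p n) :
    evt k s i i (actE p n τ σ) ↔ evt k s i i σ := by
  unfold evt
  refine forall_congr' fun t => forall_congr' fun h1 => forall_congr' fun h2 => ?_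
  have : t ∈ cpDDescentSet (actE p n τ σ) ↔ t ∈ cpDDescentSet σ := by
    obtain ⟨x, rfl⟩ : ∃ x, t = x + 1 := ⟨t - 1, by omega⟩
    rcases Nat.lt_or_eq_of_le h2 with h | h
    · rw [mem_lt _ x h, mem_lt _ x h, dkey_act, dkey_act, hτ _ (by simp; omega),
        hτ _ (by simp; omega)]
    · rw [mem_last _ x h, mem_last _ x h]
      show σ.2 (τ _) ≠ 0 ↔ _
      rw [hτ _ (by simp; omega)]
  rw [this]

lemma evt_rec (hmono : ∀ i, i < k → s i < s (i + 1)) (hlast : s k = n) {a i : ℕ}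
    (hai : a ≤ i) (hik : i + 1 < k) :
    (Finset.univ.filter fun σ : ColoredPerm p n => evt k s a i σ).card
      + (Finset.univ.filter fun σ : ColoredPerm p n => evt k s a (i + 1) σ).card
    = (Finset.univ.filter fun σ : ColoredPerm p n =>
        evt k s (i + 1) (i + 1) σ ∧ ascOn (s a) (s (i + 1)) σ).card := by
  have ha : s a < s (i + 1) := s_mono hmono (by omega) (by omega)
  have hn' : s (i + 1) < n := hlast ▸ s_mono hmono hik le_rfl
  have hbig : ∀ j, i < j → j ≤ k → s (i + 1) ≤ s j := by
    intro j h1 h2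
    rcases Nat.lt_or_eq_of_le (show i + 1 ≤ j from h1) with h | rfl
    · exact (s_mono hmono h h2).le
    · exact le_rfl
  have hbig' : ∀ j, i + 1 < j → j ≤ k → s (i + 1) < s j := fun j h1 h2 => s_mono hmono h1 h2
  rw [← Finset.card_union_of_disjoint]
  · congr 1
    ext σ
    simp only [Finset.mem_union, Finset.mem_filter, Finset.mem_univ, true_and]
    constructor
    · rintro (h | h)
      · refine ⟨fun t h1 h2 => ?_, fun t h1 h2 ht => ?_⟩
        · rw [h t (by omega) h2]
          constructor
          · rintro ⟨j, h3, h4, rfl⟩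
            refine ⟨j, ?_, h4, rfl⟩
            by_contra hc
            have : j = i + 1 := by omega
            subst this; omega
          · rintro ⟨j, h3, h4, rfl⟩
            exact ⟨j, by omega, h4, rfl⟩
        · obtain ⟨j, h3, h4, rfl⟩ := (h t h1 (by omega)).mp ht
          have := hbig j h3 h4
          omega
      · refine ⟨fun t h1 h2 => h t (by omega) h2, fun t h1 h2 ht => ?_⟩
        obtain ⟨j, h3, h4, rfl⟩ := (h t h1 (by omega)).mp ht
        have := hbig j (by omega) h4
        omega
    · rintro ⟨h, hasc⟩
      by_cases hm : s (i + 1) ∈ cpDDescentSet σ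
      · left
        intro t h1 h2
        rcases lt_trichotomy t (s (i + 1)) with h3 | h3 | h3
        · refine iff_of_false (hasc t h1 h3) ?_
          rintro ⟨j, h4, h5, rfl⟩
          have := hbig j h4 h5
          omega
        · subst h3
          exact iff_of_true hm ⟨i + 1, by omega, by omega, rfl⟩
        · rw [h t h3 h2]
          constructor
          · rintro ⟨j, h3, h4, rfl⟩
            exact ⟨j, by omega, h4, rfl⟩
          · rintro ⟨j, h5, h4, rfl⟩
            refine ⟨j, ?_, h4, rfl⟩
            by_contra hc
            have : j = i + 1 := by omega
            subst this; omega
      · right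
        intro t h1 h2
        rcases lt_or_ge (s (i + 1)) t with h3 | h3
        · exact h t h3 h2
        · refine iff_of_false ?_ ?_
          · rcases Nat.lt_or_eq_of_le h3 with h4 | rfl
            · exact hasc t h1 h4
            · exact hm
          · rintro ⟨j, h4, h5, rfl⟩
            have := hbig' j h4 h5
            omega
  · rw [Finset.disjoint_filter]
    intro σ _ h h'
    have h1 := (h (s (i + 1)) ha hn'.le).mpr ⟨i + 1, by omega, by omega, rfl⟩
    obtain ⟨j, h3, h4, h5⟩ := (h' (s (i + 1)) ha hn'.le).mp h1
    have := hbig' j h3 h4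
    omega

lemma evt_base (hmono : ∀ i, i < k → s i < s (i + 1)) (hlast : s k = n) {a i : ℕ}
    (hai : a ≤ i) (hik : i + 1 = k) :
    (Finset.univ.filter fun σ : ColoredPerm p n => evt k s a i σ).card
      + (Finset.univ.filter fun σ : ColoredPerm p n =>
          zeroOn (s a) σ ∧ ascOn (s a) n σ).card
    = (Finset.univ.filter fun σ : ColoredPerm p n =>
        trv σ ∧ ascOn (s a) n σ).card := by
  have ha : s a < n := hlast ▸ s_mono hmono (by omega) (by omega)
  have hex : ∀ t, (∃ j, i < j ∧ j ≤ k ∧ t = s j) ↔ t = n := by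
    intro t
    constructor
    · rintro ⟨j, h1, h2, rfl⟩
      have : j = k := by omega
      rw [this, hlast]
    · rintro rfl
      exact ⟨k, by omega, le_rfl, hlast.symm⟩
  obtain ⟨N, rfl⟩ : ∃ N, n = N + 1 := ⟨n - 1, by omega⟩
  rw [← Finset.card_union_of_disjoint]
  · congr 1
    ext σ
    simp only [Finset.mem_union, Finset.mem_filter, Finset.mem_univ, true_and, evt, hex]
    have ht : trv σ := trivial
    simp only [ht, true_and]
    constructor
    · rintro (h | h)
      · intro t h1 h2 ht
        have := (h t h1 h2.le).mp ht
        omega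
      · exact h.2
    · intro h
      by_cases hm : N + 1 ∈ cpDDescentSet σ
      · left
        intro t h1 h2
        rcases Nat.lt_or_eq_of_le h2 with h3 | rfl
        · exact iff_of_false (h t h1 h3) (by omega)
        · exact iff_of_true hm rfl
      · right
        refine ⟨fun x hx => ?_, h⟩
        rw [mem_last σ N rfl, not_not] at hm
        have h4 := ascOn_le le_rfl h x hx (N - x) (by omega)
        have h5 : (⟨(x : ℕ) + (N - x), by omega⟩ : Fin (N + 1)) = ⟨N, by omega⟩ :=
          Fin.ext (by simp; omega)
        rw [h5] at h4
        rw [dkey, dkey, Prod.Lex.toLex_le_toLex, hm, (rho_zero_iff (0 : ZMod p)).mpr rfl] at h4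
        rw [← rho_zero_iff]
        simp at h4
        exact h4.1
  · rw [Finset.disjoint_filter]
    rintro σ _ h ⟨h', -⟩
    have h1 := (h (N + 1) ha le_rfl).mpr ((hex _).mpr rfl)
    rw [mem_last σ N rfl] at h1
    exact h1 (h' _ (by simp; omega))

lemma zero_inv (b : ℕ) (τ : Equiv.Perm (Fin n))
    (hτ : ∀ x : Fin n, ¬ (b ≤ (x : ℕ) ∧ (x : ℕ) < n) → τ x = x) (σ : ColoredPerm p n) :
    (∀ x : Fin n, b ≤ (x : ℕ) → (actE p n τ σ).2 x = 0) ↔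
      (∀ x : Fin n, b ≤ (x : ℕ) → σ.2 x = 0) := by
  have key : ∀ x : Fin n, b ≤ (τ x : ℕ) ↔ b ≤ (x : ℕ) := by
    intro x
    by_cases hx : b ≤ (x : ℕ)
    · refine iff_of_true ?_ hx
      by_contra hc
      have := τ.injective (hτ (τ x) (by tauto))
      rw [this] at hc
      exact hc hx
    · rw [hτ x (by tauto)]
  show (∀ x : Fin n, b ≤ (x : ℕ) → σ.2 (τ x) = 0) ↔ _
  constructor
  · intro h x hx
    have := h (τ.symm x) (by rw [← key]; simpa using hx)
    simpa using this
  · intro h x hx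
    exact h _ ((key x).mpr hx)

def gfun (p n k : ℕ) (s : ℕ → ℕ) (i j : ℕ) : ℝ :=
  if j = k - 1 then (1 - ((p : ℝ)⁻¹) ^ (n - s i)) * invFact ((n : ℤ) - s i)
  else invFact ((s (j + 1) : ℤ) - s i)

lemma card_cp : (Fintype.card (ColoredPerm p n)) = n.factorial * p ^ n := by
  simp [Fintype.card_perm, ZMod.card]

lemma evt_prob (hmono : ∀ i, i < k → s i < s (i + 1)) (hlast : s k = n) (m : ℕ) :
    ∀ a i, a ≤ i → i + m + 1 = k →
    ((Finset.univ.filter fun σ : ColoredPerm p n => evt k s a i σ).card : ℝ)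
      / (Fintype.card (ColoredPerm p n) : ℝ) = (hessM (gfun p n k s) a i m).det := by
  have hp : (p : ℝ) ≠ 0 := Nat.cast_ne_zero.mpr (NeZero.ne p)
  have hC : (Fintype.card (ColoredPerm p n) : ℝ) ≠ 0 := by
    rw [card_cp]; push_cast; positivity
  induction m with
  | zero =>
    intro a i hai hik
    have ha : s a < n := hlast ▸ s_mono hmono (by omega) (by omega)
    have h1 := evt_base (p := p) hmono hlast hai hik
    have h2 := blockCount (p := p) (a := s a) (le_refl n)
      (fun σ => zeroOn (s a) σ)
      (fun τ hτ σ => zero_inv _ τ hτ σ)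
    have h3 := blockCount (p := p) (a := s a) (le_refl n) trv
      (fun τ hτ σ => Iff.rfl)
    rw [zeroCount ha.le] at h2
    rw [Finset.filter_true_of_mem (p := trv) (fun σ _ => trivial), Finset.card_univ, card_cp] at h3
    rw [card_cp] at hC ⊢
    have hf : ((n - s a).factorial : ℝ) ≠ 0 := by positivity
    have h1' := congrArg (Nat.cast : ℕ → ℝ) h1
    have h2' := congrArg (Nat.cast : ℕ → ℝ) h2
    have h3' := congrArg (Nat.cast : ℕ → ℝ) h3
    push_cast at h1' h2' h3' hC ⊢
    have hg : (hessM (gfun p n k s) a i 0).det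
        = (1 - ((p : ℝ)⁻¹) ^ (n - s a)) * ((n - s a).factorial : ℝ)⁻¹ := by
      rw [Matrix.det_fin_one]
      simp only [hessM, Matrix.of_apply, gfun]
      rw [if_pos (by simp), if_pos (by simp; omega), invFact_sub ha.le]
    rw [hg, div_eq_iff hC, eq_sub_of_add_eq h1', eq_div_of_mul_eq hf h2', eq_div_of_mul_eq hf h3']
    have hpp : (p : ℝ) ^ n = p ^ (s a) * p ^ (n - s a) := by
      rw [← pow_add]; congr 1; omega
    rw [hpp, inv_pow]
    field_simp
  | succ m ih =>
    intro a i hai hik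
    have ha : s a < s (i + 1) := s_mono hmono (by omega) (by omega)
    have hn' : s (i + 1) < n := hlast ▸ s_mono hmono (by omega) le_rfl
    rw [hess_rec, ← ih (i + 1) (i + 1) le_rfl (by omega), ← ih a (i + 1) (by omega) (by omega)]
    · have h1 := evt_rec (p := p) hmono hlast hai (by omega)
      have h2 := blockCount (p := p) (a := s a) hn'.le (evt k s (i + 1) (i + 1))
        (fun τ hτ σ => evt_inv _ _ τ hτ σ)
      have h1' := congrArg (Nat.cast : ℕ → ℝ) h1
      have h2' := congrArg (Nat.cast : ℕ → ℝ) h2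
      push_cast at h1' h2'
      have hf : ((s (i + 1) - s a).factorial : ℝ) ≠ 0 := by positivity
      rw [eq_sub_of_add_eq h1', eq_div_of_mul_eq hf h2', gfun, if_neg (by omega),
        invFact_sub ha.le]
      ring
    · rw [gfun, if_neg (by omega)]
      simp [invFact]
    · intro x h1 h2
      have := s_mono hmono (show i + 1 < i + x by omega) (by omega)
      rw [gfun, if_neg (by omega), invFact, if_neg (by omega)]

end main

/-- **Corollary (uniform distribution on `G_{p,n}`, d-descents, case `s_k = n`).**
For `0 = s_0 < s_1 < ⋯ < s_{k-1} < s_k = n`, the probability that the d-descent set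
of a uniformly random `σ ∈ G_{p,n}` equals `{s_1,…,s_{k-1},n}` is `det(g(i,j))_{i,j=0,…,k-1}`,
with `g(i,j) = 1/(s_{j+1}-s_i)!` for `j ≤ k-2` and
`g(i,k-1) = (1 - (1/p)^{n-s_i})/(n-s_i)!`. -/
theorem statement5 (p n k : ℕ) [NeZero p] (hn : 1 ≤ n) (hk : 1 ≤ k)
    (s : ℕ → ℕ) (hs0 : s 0 = 0) (hmono : ∀ i, i < k → s i < s (i + 1))
    (hlast : s k = n) :
    ((Finset.univ.filter fun σ : ColoredPerm p n =>
        cpDDescentSet σ = (Finset.Icc 1 k).image s).card : ℝ)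
        / (Fintype.card (ColoredPerm p n) : ℝ)
      = (Matrix.of fun i j : Fin k =>
          if (j : ℕ) = k - 1 then
            (1 - ((p : ℝ)⁻¹) ^ (n - s (i : ℕ))) * invFact ((n : ℤ) - s (i : ℕ))
          else invFact ((s ((j : ℕ) + 1) : ℤ) - s (i : ℕ))).det := by
  have key := evt_prob (p := p) hmono hlast (k - 1) 0 0 le_rfl (by omega)
  have hev : ∀ σ : ColoredPerm p n, cpDDescentSet σ = (Finset.Icc 1 k).image s ↔ evt k s 0 0 σ := by
    intro σ
    have hb : ∀ j, 0 < j → j ≤ k → 0 < s j ∧ s j ≤ n := by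
      intro j h1 h2
      refine ⟨hs0 ▸ s_mono hmono h1 h2, ?_⟩
      rcases Nat.lt_or_eq_of_le h2 with h | rfl
      · exact hlast ▸ (s_mono hmono h le_rfl).le
      · exact hlast.le
    constructor
    · intro h t h1 h2
      rw [h, Finset.mem_image]
      constructor
      · rintro ⟨j, h3, rfl⟩
        rw [Finset.mem_Icc] at h3
        exact ⟨j, by omega, h3.2, rfl⟩
      · rintro ⟨j, h3, h4, rfl⟩
        exact ⟨j, by rw [Finset.mem_Icc]; omega, rfl⟩
    · intro h
      ext t
      rw [Finset.mem_image]
      constructor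
      · intro ht
        have h0 := mem_range σ t ht
        obtain ⟨j, h3, h4, rfl⟩ := (h t (by omega) h0.2).mp ht
        exact ⟨j, by rw [Finset.mem_Icc]; omega, rfl⟩
      · rintro ⟨j, h3, rfl⟩
        rw [Finset.mem_Icc] at h3
        have := hb j (by omega) h3.2
        exact (h (s j) (by omega) this.2).mpr ⟨j, by omega, h3.2, rfl⟩
  simp only [hev]
  rw [key]
  obtain ⟨K, rfl⟩ : ∃ K, k = K + 1 := ⟨k - 1, by omega⟩
  congr 1
  ext x y
  simp only [hessM, Matrix.of_apply, gfun, zero_add]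
  split_ifs <;> simp_all
end
end

section
/- Let p ≥ 2 and let σ be chosen uniformly at random from G_{p,n}. Let 0 = s_0 < s_1 < ⋯ < s_{k−1} < s_k = n. Then the probability that the set of d′-descents of σ equals {s_1,…,s_{k−1},n} is det( g′(i,j) )_{i,j = 0,…,k−1}, where g′(i,j) = 1/(s_{j+1} − s_i)! for 0 ≤ i ≤ k−1 and 0 ≤ j ≤ k−2, and g′(i,k−1) = (1 − ((p−1)/p)^{n − s_i}) / (n − s_i)! for 0 ≤ i ≤ k−1. -/
open scoped Classical

noncomputable section

/-- key -/
def ff {p n : ℕ} (σ : ColoredPerm p n) (i : Fin n) : ℕ ×ₗ ℕ :=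
  toLex ((σ.2 i).val, (σ.1 i : ℕ))

lemma ff_inj {p n : ℕ} (σ : ColoredPerm p n) : Function.Injective (ff σ) := by
  intro i j h
  have h2 := congrArg (fun x => (ofLex x).2) h
  simp only [ff, ofLex_toLex] at h2
  exact σ.1.injective (Fin.ext h2)

lemma mem_D_aux {p n : ℕ} (σ : ColoredPerm p n) (m : ℕ) :
    m ∈ cpD'DescentSet σ ↔ ∃ j : Fin n, cpHasD'DescentAt σ j ∧ (j : ℕ) + 1 = m := by
  unfold cpD'DescentSet
  rw [Finset.mem_image]
  simp [Finset.bind_def, Finset.mem_sup, Finset.pure_def]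

lemma mem_D_iff {p n : ℕ} (σ : ColoredPerm p n) (i : Fin n) :
    (i : ℕ) + 1 ∈ cpD'DescentSet σ ↔ cpHasD'DescentAt σ i := by
  rw [mem_D_aux]
  constructor
  · rintro ⟨j, hj, hji⟩
    have : j = i := Fin.ext (by omega)
    exact this ▸ hj
  · intro h
    exact ⟨i, h, rfl⟩

lemma D_bound {p n : ℕ} (σ : ColoredPerm p n) {m : ℕ} (h : m ∈ cpD'DescentSet σ) :
    1 ≤ m ∧ m ≤ n := by
  rw [mem_D_aux] at h
  obtain ⟨j, hj, rfl⟩ := h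
  have := j.2
  omega

lemma mem_D_lt {p n : ℕ} [NeZero p] (σ : ColoredPerm p n) (m : ℕ) (h : m + 1 < n) :
    m + 1 ∈ cpD'DescentSet σ ↔ ff σ ⟨m + 1, h⟩ < ff σ ⟨m, by omega⟩ := by
  have := mem_D_iff σ ⟨m, by omega⟩
  simp only at this
  rw [this]
  unfold cpHasD'DescentAt
  rw [dif_pos h]
  unfold sigmaLt' cpPair ff
  rw [Prod.Lex.toLex_lt_toLex]
  simp only [(ZMod.val_injective p).eq_iff]
  simp

lemma mem_D_last {p n : ℕ} (σ : ColoredPerm p n) (m : ℕ) (h : m + 1 = n) :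
    m + 1 ∈ cpD'DescentSet σ ↔ σ.2 ⟨m, by omega⟩ = ((p - 1 : ℕ) : ZMod p) := by
  have := mem_D_iff σ ⟨m, by omega⟩
  simp only at this
  rw [this]
  unfold cpHasD'DescentAt
  rw [dif_neg (by simp; omega)]

abbrev Blk (n a b : ℕ) := {i : Fin n // a ≤ (i : ℕ) ∧ (i : ℕ) < b}

lemma card_Blk (n a b : ℕ) (hb : b ≤ n) : Fintype.card (Blk n a b) = b - a := by
  rw [← Nat.card_Ico a b, Fintype.card_subtype]
  refine Finset.card_bij (fun i _ => (i : ℕ)) ?_ ?_ ?_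
  · intro i hi; simpa using hi
  · intro i _ j _ h; exact Fin.ext h
  · intro m hm
    rw [Finset.mem_Ico] at hm
    exact ⟨⟨m, by omega⟩, by simpa using hm, rfl⟩

def Asc {p n : ℕ} (a b : ℕ) (σ : ColoredPerm p n) : Prop :=
  ∀ m, a < m → m < b → m ∉ cpD'DescentSet σ

lemma asc_iff {p n : ℕ} [NeZero p] (a b : ℕ) (hb : b ≤ n) (σ : ColoredPerm p n) :
    Asc a b σ ↔ StrictMono (fun x : Blk n a b => ff σ x.1) := by
  constructor
  · intro h
    have key : ∀ j (hj : j < b) i (hi : i < j), a ≤ i →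
        ff σ ⟨i, by omega⟩ < ff σ ⟨j, by omega⟩ := by
      intro j
      induction j with
      | zero => intro _ i hi; omega
      | succ j ih =>
        intro hj i hi ha
        have h1 := h (j + 1) (by omega) hj
        rw [mem_D_lt σ j (by omega), not_lt] at h1
        have h2 : ff σ ⟨j, by omega⟩ < ff σ ⟨j + 1, by omega⟩ := by
          refine lt_of_le_of_ne h1 ?_
          intro he
          have := ff_inj σ he
          simp at this
        rcases Nat.lt_or_ge i j with hij | hij
        · exact (ih (by omega) i hij ha).trans h2
        · have : i = j := by omega
          subst this; exact h2
    rintro ⟨⟨i, hi⟩, hi1⟩ ⟨⟨j, hj⟩, hj1⟩ hij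
    exact key j hj1.2 i (by simpa using hij) hi1.1
  · intro h m ham hmb hm
    obtain ⟨m, rfl⟩ : ∃ m', m = m' + 1 := ⟨m - 1, by omega⟩
    rw [mem_D_lt σ m (by omega)] at hm
    have := @h ⟨⟨m, by omega⟩, by simp; omega⟩ ⟨⟨m + 1, by omega⟩, by simp; omega⟩
      (by simp)
    exact lt_asymm hm this

lemma exists_unique_sort {B : Type*} [Fintype B] [LinearOrder B] {L : Type*} [LinearOrder L]
    (f : B → L) (hf : Function.Injective f) :
    ∃! τ : Equiv.Perm B, StrictMono (f ∘ τ) := by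
  obtain ⟨e⟩ : Nonempty (Fin (Fintype.card B) ≃o B) :=
    ⟨monoEquivOfFin B rfl⟩
  have hm := Tuple.monotone_sort (f ∘ e)
  have hs := hm.strictMono_of_injective
    ((hf.comp e.injective).comp (Tuple.sort (f ∘ e)).injective)
  refine ⟨(e.symm.toEquiv.trans (Tuple.sort (f ∘ e))).trans e.toEquiv, ?_, ?_⟩
  · exact hs.comp e.symm.strictMono
  · have uniq : ∀ τ τ' : Equiv.Perm B, StrictMono (f ∘ τ) → StrictMono (f ∘ τ') → τ = τ' := by
      intro τ τ' h h'
      have hsm : StrictMono (τ'.trans τ.symm) := by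
        intro x y hxy
        rw [← h.lt_iff_lt]
        simpa using h' hxy
      let o : B ≃o B := StrictMono.orderIsoOfSurjective _ hsm (τ'.trans τ.symm).surjective
      have ho : o = OrderIso.refl B := by
        have : WellFoundedLT B := inferInstance
        exact Subsingleton.elim _ _
      ext x
      have := congrArg (fun o : B ≃o B => τ (o x)) ho
      simp [o] at this
      exact this.symm
    intro τ hτ
    exact uniq _ _ hτ (hs.comp e.symm.strictMono)

/-- right action of permutations -/
def act {p n : ℕ} (τ : Equiv.Perm (Fin n)) : ColoredPerm p n ≃ ColoredPerm p n where
  toFun σ := (σ.1 * τ, σ.2 ∘ τ)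
  invFun σ := (σ.1 * τ⁻¹, σ.2 ∘ τ.symm)
  left_inv σ := by ext <;> simp
  right_inv σ := by ext <;> simp

lemma ff_act {p n : ℕ} (τ : Equiv.Perm (Fin n)) (σ : ColoredPerm p n) (i : Fin n) :
    ff (act τ σ) i = ff σ (τ i) := rfl

lemma count_asc {p n : ℕ} [NeZero p] (a b : ℕ) (hb : b ≤ n) (E : ColoredPerm p n → Prop)
    (hE : ∀ (τ : Equiv.Perm (Blk n a b)) σ, E (act (Equiv.Perm.ofSubtype τ) σ) ↔ E σ) :
    (Finset.univ.filter fun σ : ColoredPerm p n => Asc a b σ ∧ E σ).card * (b - a).factorial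
      = (Finset.univ.filter fun σ : ColoredPerm p n => E σ).card := by
  have h1 : ∀ τ : Equiv.Perm (Blk n a b),
      (Finset.univ.filter fun σ : ColoredPerm p n =>
        Asc a b (act (Equiv.Perm.ofSubtype τ) σ) ∧ E σ).card =
      (Finset.univ.filter fun σ : ColoredPerm p n => Asc a b σ ∧ E σ).card := by
    intro τ
    refine Finset.card_equiv (act (Equiv.Perm.ofSubtype τ)) ?_
    intro σ
    simp [hE]
  have h2 : ∀ σ : ColoredPerm p n,
      (Finset.univ.filter fun τ : Equiv.Perm (Blk n a b) =>
        Asc a b (act (Equiv.Perm.ofSubtype τ) σ)).card = 1 := by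
    intro σ
    obtain ⟨τ, h, hu⟩ := exists_unique_sort (fun x : Blk n a b => ff σ x.1)
      ((ff_inj σ).comp Subtype.val_injective)
    have hiff : ∀ τ : Equiv.Perm (Blk n a b), Asc a b (act (Equiv.Perm.ofSubtype τ) σ) ↔
        StrictMono ((fun x : Blk n a b => ff σ x.1) ∘ τ) := by
      intro τ
      rw [asc_iff a b hb]
      have : (fun x : Blk n a b => ff (act (Equiv.Perm.ofSubtype τ) σ) x.1) =
          ((fun x : Blk n a b => ff σ x.1) ∘ τ) := by
        funext x
        simp only [ff_act, Function.comp, Equiv.Perm.ofSubtype_apply_coe]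
      rw [this]
    rw [Finset.card_eq_one]
    refine ⟨τ, ?_⟩
    ext τ'
    simp only [Finset.mem_filter, Finset.mem_univ, true_and, Finset.mem_singleton, hiff]
    exact ⟨hu τ', fun e => e ▸ h⟩
  have h3 : ∑ τ : Equiv.Perm (Blk n a b), (Finset.univ.filter fun σ : ColoredPerm p n =>
        Asc a b (act (Equiv.Perm.ofSubtype τ) σ) ∧ E σ).card
      = (Finset.univ.filter fun σ : ColoredPerm p n => E σ).card := by
    simp only [Finset.card_filter]
    rw [Finset.sum_comm]
    refine Finset.sum_congr rfl fun σ _ => ?_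
    by_cases h : E σ
    · simp only [h, and_true, if_true]
      rw [← Finset.card_filter]; exact h2 σ
    · simp [h]
  rw [← h3, Finset.sum_congr rfl (fun τ _ => h1 τ), Finset.sum_const, Finset.card_univ,
    Fintype.card_perm, card_Blk n a b hb, smul_eq_mul, mul_comm]

def Ex {p n : ℕ} (S : Finset ℕ) (b : ℕ) (σ : ColoredPerm p n) : Prop :=
  ∀ m, b < m → (m ∈ cpD'DescentSet σ ↔ m ∈ S)

lemma act_D {p n : ℕ} [NeZero p] (a b : ℕ) (τ : Equiv.Perm (Blk n a b)) (σ : ColoredPerm p n)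
    (m : ℕ) (hm : b < m) :
    m ∈ cpD'DescentSet (act (Equiv.Perm.ofSubtype τ) σ) ↔ m ∈ cpD'DescentSet σ := by
  obtain ⟨m, rfl⟩ : ∃ m', m = m' + 1 := ⟨m - 1, by omega⟩
  have hfix : ∀ i : Fin n, b ≤ i → Equiv.Perm.ofSubtype τ i = i := by
    intro i hi
    exact Equiv.Perm.ofSubtype_apply_of_not_mem τ (by omega)
  rcases lt_trichotomy (m + 1) n with h | h | h
  · rw [mem_D_lt _ m h, mem_D_lt _ m h, ff_act, ff_act, hfix _ (by simp; omega),
      hfix _ (by simp; omega)]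
  · rw [mem_D_last _ m h, mem_D_last _ m h]
    simp only [act, Equiv.coe_fn_mk, Function.comp]
    rw [hfix _ (by simp; omega)]
  · constructor <;> intro h' <;> have := D_bound _ h' <;> omega

lemma count_colors {p n : ℕ} [NeZero p] (a : ℕ) (ha : a ≤ n) (c : ZMod p) :
    (Finset.univ.filter fun σ : ColoredPerm p n => ∀ x : Fin n, a ≤ (x : ℕ) → σ.2 x ≠ c).card
      = n.factorial * ((p - 1) ^ (n - a) * p ^ a) := by
  have h : (Finset.univ.filter fun σ : ColoredPerm p n =>
      ∀ x : Fin n, a ≤ (x : ℕ) → σ.2 x ≠ c) =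
      (Finset.univ : Finset (Equiv.Perm (Fin n))) ×ˢ
        Fintype.piFinset (fun x : Fin n => if a ≤ (x : ℕ) then Finset.univ.erase c
          else (Finset.univ : Finset (ZMod p))) := by
    ext σ
    simp only [Finset.mem_filter, Finset.mem_univ, true_and, Finset.mem_product,
      Fintype.mem_piFinset]
    refine forall_congr' fun x => ?_
    split_ifs with hx <;> simp [hx]
  rw [h, Finset.card_product, Fintype.card_piFinset, Finset.card_univ, Fintype.card_perm,
    Fintype.card_fin]
  congr 1
  have h2 : ∀ x : Fin n, (if a ≤ (x : ℕ) then Finset.univ.erase c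
          else (Finset.univ : Finset (ZMod p))).card =
        if a ≤ (x : ℕ) then p - 1 else p := by
    intro x
    split_ifs
    · rw [Finset.card_erase_of_mem (Finset.mem_univ _), Finset.card_univ, ZMod.card]
    · rw [Finset.card_univ, ZMod.card]
  rw [Finset.prod_congr rfl (fun x _ => h2 x),
    Fin.prod_univ_eq_prod_range (fun x => if a ≤ x then p - 1 else p) n,
    ← Finset.prod_range_mul_prod_Ico _ ha, mul_comm]
  congr 1
  · rw [Finset.prod_congr rfl (g := fun _ => p - 1)]
    · simp
    · intro x hx; rw [Finset.mem_Ico] at hx; simp [hx.1]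
  · rw [Finset.prod_congr rfl (g := fun _ => p)]
    · simp
    · intro x hx; rw [Finset.mem_range] at hx; rw [if_neg (by omega)]

lemma det_lemma (k : ℕ) (U : ℕ → ℕ → ℝ) (h q : ℕ → ℝ)
    (hU1 : ∀ i, i < k + 1 → U i i = 1) (hU0 : ∀ i j, j < i → i < k + 1 → U i j = 0)
    (hq : ∀ i, i < k + 1 → ∑ j ∈ Finset.range (k + 1), (-1) ^ j * U i j * q j = (-1) ^ k * h i) :
    q 0 = (Matrix.of fun i j : Fin (k + 1) =>
      if (j : ℕ) = k then h i else U i (j + 1)).det := by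
  let A : Matrix (Fin (k + 1)) (Fin (k + 1)) ℝ := Matrix.of fun i j => U i j
  have hA : A.det = 1 := by
    rw [Matrix.det_of_isUpperTriangular]
    · exact Finset.prod_eq_one fun i _ => hU1 i i.2
    · intro i j hij
      exact hU0 i j hij i.2
  let x : Fin (k + 1) → ℝ := fun j => (-1) ^ (j : ℕ) * q j
  have hAx : A.mulVec x = fun i : Fin (k + 1) => (-1) ^ k * h i := by
    funext i
    have hs := Fin.sum_univ_eq_sum_range (fun j : ℕ => (-1 : ℝ) ^ j * U i j * q j) (k + 1)
    rw [← hq i i.2, ← hs]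
    change ∑ j, A i j * x j = _
    refine Finset.sum_congr rfl fun j _ => ?_
    simp only [A, x, Matrix.of_apply]; ring
  have hc : A.cramer (A.mulVec x) 0 = x 0 := by
    rw [Matrix.cramer_eq_adjugate_mulVec, Matrix.mulVec_mulVec, Matrix.adjugate_mul, hA]
    simp
  rw [hAx, Matrix.cramer_apply] at hc
  have hx0 : x 0 = q 0 := by simp [x]
  rw [← hx0, ← hc]
  have h1 := Matrix.det_permute' (finRotate (k + 1))
    (A.updateCol 0 (fun i : Fin (k + 1) => (-1) ^ k * h i))
  rw [sign_finRotate] at h1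
  have h2 : (A.updateCol 0 (fun i : Fin (k + 1) => (-1) ^ k * h i)) =
      A.updateCol 0 ((-1 : ℝ) ^ k • (fun i : Fin (k + 1) => h i)) := rfl
  rw [h2, Matrix.det_updateCol_smul]
  rw [h2, Matrix.det_updateCol_smul] at h1
  have h3 : ((A.updateCol 0 ((-1 : ℝ) ^ k • (fun i : Fin (k + 1) => h i))).submatrix id
      (finRotate (k + 1))) =
      (Matrix.of fun i j : Fin (k + 1) =>
      if (j : ℕ) = k then h i else U i (j + 1)).updateCol (Fin.last k)
        ((-1 : ℝ) ^ k • (fun i : Fin (k + 1) => h i)) := by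
    ext i j
    rw [Matrix.submatrix_apply]
    by_cases hj : j = Fin.last k
    · subst hj
      simp [finRotate_last]
    · have hjk : (j : ℕ) < k := by
        have := j.2
        have : (j : ℕ) ≠ k := fun e => hj (Fin.ext e)
        omega
      have hr : ((finRotate (k + 1) j : Fin (k + 1)) : ℕ) = j + 1 :=
        coe_finRotate_of_ne_last hj
      rw [Matrix.updateCol_ne, Matrix.updateCol_ne hj]
      · simp only [A, Matrix.of_apply, hr, id]
        rw [if_neg (by omega)]
      · intro e
        rw [e] at hr
        simp at hr
  rw [h3, Matrix.det_updateCol_smul] at h1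
  have h4 : (Matrix.of fun i j : Fin (k + 1) =>
      if (j : ℕ) = k then h i else U i (j + 1)).updateCol (Fin.last k)
        (fun i : Fin (k + 1) => h i) = (Matrix.of fun i j : Fin (k + 1) =>
      if (j : ℕ) = k then h i else U i (j + 1)) := by
    ext i j
    by_cases hj : j = Fin.last k
    · subst hj; simp
    · rw [Matrix.updateCol_ne hj]
  rw [h4] at h1
  have hs : ((-1 : ℝ) ^ k) * (-1) ^ k = 1 := by
    rw [← mul_pow]; simp
  push_cast at h1
  linear_combination (-(-1 : ℝ) ^ k) * h1 + 
    ((-1 : ℝ) ^ k * (A.updateCol 0 (fun i : Fin (k + 1) => h i)).det - 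
      (Matrix.of fun i j : Fin (k + 1) =>
      if (j : ℕ) = k then h i else U i (j + 1)).det) * (-hs)

/-- counting -/
def ct (p n : ℕ) [NeZero p] (E : ColoredPerm p n → Prop) : ℝ :=
  ((Finset.univ.filter E).card : ℝ)

lemma ct_eq {p n : ℕ} [NeZero p] (E : ColoredPerm p n → Prop) [inst : DecidablePred E] :
    ct p n E = ((Finset.univ.filter E).card : ℝ) := by
  unfold ct
  congr!

lemma ct_congr {p n : ℕ} [NeZero p] {E F : ColoredPerm p n → Prop} (h : ∀ σ, E σ ↔ F σ) :
    ct p n E = ct p n F := by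
  have : E = F := funext fun σ => propext (h σ)
  rw [this]

lemma ct_add {p n : ℕ} [NeZero p] (E F : ColoredPerm p n → Prop) :
    ct p n E = ct p n (fun σ => E σ ∧ F σ) + ct p n (fun σ => E σ ∧ ¬ F σ) := by
  rw [ct_eq E, ct_eq (fun σ => E σ ∧ F σ), ct_eq (fun σ => E σ ∧ ¬ F σ), ← Nat.cast_add,
    ← Finset.filter_filter, ← Finset.filter_filter]
  rw [Finset.card_filter_add_card_filter_not]

lemma s_lt {s : ℕ → ℕ} {k : ℕ} (hmono : ∀ i, i < k → s i < s (i + 1)) :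
    ∀ j, j ≤ k → ∀ i, i < j → s i < s j := by
  intro j
  induction j with
  | zero => intro _ i hi; omega
  | succ j ih =>
    intro hj i hi
    have h1 := hmono j (by omega)
    rcases Nat.lt_or_ge i j with h | h
    · exact (ih (by omega) i h).trans h1
    · have : i = j := by omega
      subst this; exact h1

lemma mem_S_between {s : ℕ → ℕ} {k : ℕ} (hmono : ∀ i, i < k → s i < s (i + 1))
    {t m : ℕ} (ht : t < k) (h1 : s t < m) (h2 : m < s (t + 1)) :
    m ∉ (Finset.Icc 1 k).image s := by
  intro hm
  rw [Finset.mem_image] at hm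
  obtain ⟨j, hj, rfl⟩ := hm
  rw [Finset.mem_Icc] at hj
  rcases Nat.lt_or_ge t j with h | h
  · rcases Nat.lt_or_ge (t + 1) j with h' | h'
    · have := s_lt hmono j hj.2 (t + 1) h'; omega
    · have : j = t + 1 := by omega
      subst this; omega
  · rcases Nat.lt_or_ge j t with h' | h'
    · have := s_lt hmono t ht.le j h'; omega
    · have : j = t := by omega
      subst this; omega

lemma Ex_step {p n k : ℕ} {s : ℕ → ℕ} (hmono : ∀ i, i < k → s i < s (i + 1))
    {t : ℕ} (ht : t < k) (σ : ColoredPerm p n) :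
    Ex ((Finset.Icc 1 k).image s) (s t) σ ↔
      Asc (s t) (s (t + 1)) σ ∧ s (t + 1) ∈ cpD'DescentSet σ ∧
        Ex ((Finset.Icc 1 k).image s) (s (t + 1)) σ := by
  have hlt := hmono t ht
  have hmem : s (t + 1) ∈ (Finset.Icc 1 k).image s :=
    Finset.mem_image_of_mem _ (Finset.mem_Icc.2 ⟨by omega, by omega⟩)
  constructor
  · intro h
    refine ⟨fun m h1 h2 hm => mem_S_between hmono ht h1 h2 ((h m h1).1 hm),
      (h _ hlt).2 hmem, fun m hm => h m (by omega)⟩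
  · rintro ⟨h1, h2, h3⟩ m hm
    rcases lt_trichotomy m (s (t + 1)) with h | h | h
    · exact iff_of_false (h1 m hm h) (mem_S_between hmono ht hm h)
    · subst h; exact iff_of_true h2 hmem
    · exact h3 m h

lemma Asc_step {p n a b c : ℕ} (σ : ColoredPerm p n) (hab : a < b) (hbc : b < c) :
    Asc a c σ ↔ Asc a b σ ∧ b ∉ cpD'DescentSet σ ∧ Asc b c σ := by
  constructor
  · intro h
    exact ⟨fun m h1 h2 => h m h1 (by omega), h b hab hbc, fun m h1 h2 => h m (by omega) h2⟩
  · rintro ⟨h1, h2, h3⟩ m hm hm'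
    rcases lt_trichotomy m b with h | h | h
    · exact h1 m hm h
    · exact h ▸ h2
    · exact h3 m h hm'

lemma alt_sum {p n k : ℕ} [NeZero p] {s : ℕ → ℕ} (hmono : ∀ i, i < k → s i < s (i + 1))
    (i : ℕ) (d : ℕ) (hd : i + d < k) :
    ∑ j ∈ Finset.Ico i (i + d + 1), (-1 : ℝ) ^ j *
      ct p n (fun σ => Asc (s i) (s j) σ ∧ Ex ((Finset.Icc 1 k).image s) (s j) σ)
    = (-1) ^ (i + d) * ct p n (fun σ => Asc (s i) (s (i + d + 1)) σ ∧
        s (i + d + 1) ∈ cpD'DescentSet σ ∧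
        Ex ((Finset.Icc 1 k).image s) (s (i + d + 1)) σ) := by
  induction d with
  | zero =>
    simp only [add_zero, Nat.Ico_succ_singleton, Finset.sum_singleton]
    congr 1
    refine ct_congr fun σ => ?_
    rw [Ex_step hmono (by omega) σ]
    constructor
    · exact fun h => h.2
    · exact fun h => ⟨fun m h1 h2 => by omega, h⟩
  | succ d ih =>
    rw [Finset.sum_Ico_succ_top (by omega), ← add_assoc, ih (by omega)]
    rw [ct_add (fun σ => Asc (s i) (s (i + d + 1)) σ ∧
        Ex ((Finset.Icc 1 k).image s) (s (i + d + 1)) σ)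
      (fun σ => s (i + d + 1) ∈ cpD'DescentSet σ)]
    have e1 : ct p n (fun σ => (Asc (s i) (s (i + d + 1)) σ ∧
        Ex ((Finset.Icc 1 k).image s) (s (i + d + 1)) σ) ∧ s (i + d + 1) ∈ cpD'DescentSet σ) =
        ct p n (fun σ => Asc (s i) (s (i + d + 1)) σ ∧
        s (i + d + 1) ∈ cpD'DescentSet σ ∧
        Ex ((Finset.Icc 1 k).image s) (s (i + d + 1)) σ) := ct_congr fun σ => by tauto
    have e2 : ct p n (fun σ => (Asc (s i) (s (i + d + 1)) σ ∧
        Ex ((Finset.Icc 1 k).image s) (s (i + d + 1)) σ) ∧ ¬ s (i + d + 1) ∈ cpD'DescentSet σ) =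
        ct p n (fun σ => Asc (s i) (s (i + d + 1 + 1)) σ ∧
        s (i + d + 1 + 1) ∈ cpD'DescentSet σ ∧
        Ex ((Finset.Icc 1 k).image s) (s (i + d + 1 + 1)) σ) := ct_congr fun σ => by
      rw [Ex_step hmono (by omega : i + d + 1 < k) σ,
        Asc_step σ (s_lt hmono (i + d + 1) (by omega) i (by omega))
          (hmono (i + d + 1) (by omega))]
      tauto
    rw [e1, e2]
    ring

lemma a_eq {p n : ℕ} [NeZero p] (a b : ℕ) (hab : a ≤ b) (hb : b ≤ n) (S : Finset ℕ) :
    ct p n (fun σ => Asc a b σ ∧ Ex S b σ) = invFact ((b : ℤ) - a) * ct p n (Ex S b) := by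
  have h := count_asc (p := p) a b hb (Ex S b) (by
    intro τ σ
    unfold Ex
    refine forall_congr' fun m => forall_congr' fun hm => ?_
    rw [act_D a b τ σ m hm])
  have hi : invFact ((b : ℤ) - a) = ((b - a).factorial : ℝ)⁻¹ := by
    unfold invFact
    rw [if_pos (by omega)]
    congr 3; omega
  rw [ct_eq (fun σ => Asc a b σ ∧ Ex S b σ), ct_eq (Ex S b), hi, ← h]
  have : ((b - a).factorial : ℝ) ≠ 0 := by positivity
  push_cast
  field_simp

lemma last_iff {p n : ℕ} [NeZero p] (hp : 2 ≤ p) (a : ℕ) (ha : a < n) (σ : ColoredPerm p n)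
    (h : Asc a n σ) :
    n ∈ cpD'DescentSet σ ↔ ¬ ∀ x : Fin n, a ≤ (x : ℕ) → σ.2 x ≠ ((p - 1 : ℕ) : ZMod p) := by
  obtain ⟨m, rfl⟩ : ∃ m', n = m' + 1 := ⟨n - 1, by omega⟩
  rw [mem_D_last σ m rfl]
  constructor
  · intro h1 h2
    exact h2 _ (by simp; omega) h1
  · intro h2
    push Not at h2
    obtain ⟨x, hx, hc⟩ := h2
    rw [asc_iff a _ le_rfl] at h
    have hle := h.monotone (a := ⟨x, hx, x.2⟩) (b := ⟨⟨m, by omega⟩, by simp; omega⟩)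
      (by
        have := x.2
        rw [Subtype.mk_le_mk, Fin.le_def]; simp; omega)
    simp only [ff] at hle
    rw [Prod.Lex.toLex_le_toLex, hc] at hle
    have hv : (((p - 1 : ℕ) : ZMod p)).val = p - 1 := ZMod.val_cast_of_lt (by omega)
    have hlt := ZMod.val_lt (σ.2 ⟨m, by omega⟩)
    apply ZMod.val_injective p
    rw [hv] at hle ⊢
    simp only at hle
    omega

lemma b_eq {p n : ℕ} [NeZero p] (hp : 2 ≤ p) (a : ℕ) (ha : a < n) :
    ct p n (fun σ => Asc a n σ ∧ n ∈ cpD'DescentSet σ) =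
      (1 - (((p : ℝ) - 1) / p) ^ (n - a)) * invFact ((n : ℤ) - a) *
        (Fintype.card (ColoredPerm p n) : ℝ) := by
  have hX : (Fintype.card (ColoredPerm p n) : ℝ) = n.factorial * p ^ n := by
    rw [Fintype.card_prod, Fintype.card_perm, Fintype.card_fun, ZMod.card, Fintype.card_fin]
    push_cast; rfl
  rw [ct_congr (F := fun σ => Asc a n σ ∧
    ¬ ∀ x : Fin n, a ≤ (x : ℕ) → σ.2 x ≠ ((p - 1 : ℕ) : ZMod p))
    (fun σ => and_congr_right fun h => last_iff hp a ha σ h)]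
  have h := count_asc (p := p) a n le_rfl
    (fun σ => ¬ ∀ x : Fin n, a ≤ (x : ℕ) → σ.2 x ≠ ((p - 1 : ℕ) : ZMod p)) (by
    intro τ σ
    rw [not_iff_not]
    have hT : ∀ (τ : Equiv.Perm (Blk n a n)) (x : Fin n), a ≤ (x : ℕ) →
        a ≤ ((Equiv.Perm.ofSubtype τ x : Fin n) : ℕ) := by
      intro τ x hx
      rw [Equiv.Perm.ofSubtype_apply_of_mem τ ⟨hx, x.2⟩]
      exact (τ ⟨x, hx, x.2⟩).2.1
    constructor
    · intro h x hx
      have := h (Equiv.Perm.ofSubtype τ⁻¹ x) (hT _ x hx)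
      simpa [act] using this
    · intro h x hx
      exact h (Equiv.Perm.ofSubtype τ x) (hT _ x hx))
  have hc := count_colors (p := p) (n := n) a ha.le ((p - 1 : ℕ) : ZMod p)
  have hadd := ct_add (p := p) (n := n) (fun _ => True)
    (fun σ => ∀ x : Fin n, a ≤ (x : ℕ) → σ.2 x ≠ ((p - 1 : ℕ) : ZMod p))
  have hT : ct p n (fun _ => True) = (Fintype.card (ColoredPerm p n) : ℝ) := by
    unfold ct
    rw [Finset.filter_true, Finset.card_univ]
  simp only [true_and] at hadd
  rw [hT, hX] at hadd
  have hi : invFact ((n : ℤ) - a) = ((n - a).factorial : ℝ)⁻¹ := by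
    unfold invFact
    rw [if_pos (by omega)]
    congr 3; omega
  have hpc : ((p - 1 : ℕ) : ℝ) = (p : ℝ) - 1 := by
    rw [Nat.cast_sub (by omega : 1 ≤ p), Nat.cast_one]
  have h' := congrArg (Nat.cast (R := ℝ)) h
  have hc' := congrArg (Nat.cast (R := ℝ)) hc
  rw [Nat.cast_mul, ← ct_eq, ← ct_eq] at h'
  rw [← ct_eq, Nat.cast_mul, Nat.cast_mul, Nat.cast_pow, Nat.cast_pow,
    hpc] at hc'
  rw [hX, hi]
  have hf : ((n - a).factorial : ℝ) ≠ 0 := by positivity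
  have hp0 : (p : ℝ) ≠ 0 := by positivity
  have hpn : (p : ℝ) ^ n = p ^ (n - a) * p ^ a := by
    rw [← pow_add]; congr 1; omega
  have hdiv : (((p : ℝ) - 1) / p) ^ (n - a) * (n.factorial * p ^ n) =
      n.factorial * (((p : ℝ) - 1) ^ (n - a) * p ^ a) := by
    rw [hpn, div_pow]; field_simp
  rw [mul_assoc, mul_left_comm, sub_mul, hdiv, one_mul, eq_inv_mul_iff_mul_eq₀ hf, mul_comm]
  linarith

/-- **Corollary (uniform distribution on `G_{p,n}`, d′-descents, case `s_k = n`).**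
For `p ≥ 2` and `0 = s_0 < s_1 < ⋯ < s_{k-1} < s_k = n`, the probability that the
d′-descent set of a uniformly random `σ ∈ G_{p,n}` equals `{s_1,…,s_{k-1},n}` is
`det(g′(i,j))_{i,j=0,…,k-1}`, with `g′(i,j) = 1/(s_{j+1}-s_i)!` for `j ≤ k-2` and
`g′(i,k-1) = (1 - ((p-1)/p)^{n-s_i})/(n-s_i)!` (here `(p-1)/p = 1/p*`). -/
theorem statement7 (p n k : ℕ) (hp : 2 ≤ p) (hn : 1 ≤ n) (hk : 1 ≤ k)
    (s : ℕ → ℕ) (hs0 : s 0 = 0) (hmono : ∀ i, i < k → s i < s (i + 1))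
    (hlast : s k = n) :
    haveI : NeZero p := ⟨by omega⟩
    ((Finset.univ.filter fun σ : ColoredPerm p n =>
        cpD'DescentSet σ = (Finset.Icc 1 k).image s).card : ℝ)
        / (Fintype.card (ColoredPerm p n) : ℝ)
      = (Matrix.of fun i j : Fin k =>
          if (j : ℕ) = k - 1 then
            (1 - (((p : ℝ) - 1) / p) ^ (n - s (i : ℕ))) * invFact ((n : ℤ) - s (i : ℕ))
          else invFact ((s ((j : ℕ) + 1) : ℤ) - s (i : ℕ))).det := by
  haveI inst : NeZero p := ⟨by omega⟩
  obtain ⟨k, rfl⟩ : ∃ k', k = k' + 1 := ⟨k - 1, by omega⟩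
  have hcard : (Fintype.card (ColoredPerm p n) : ℝ) ≠ 0 := by
    have : 0 < Fintype.card (ColoredPerm p n) := Fintype.card_pos
    positivity
  have hsl := s_lt hmono
  have hsle : ∀ i j, i ≤ j → j ≤ k + 1 → s i ≤ s j := by
    intro i j hij hj
    rcases hij.lt_or_eq with h | h
    · exact (hsl j hj i h).le
    · rw [h]
  have hdet := det_lemma k (fun i j => invFact ((s j : ℤ) - s i))
    (fun i => (1 - (((p : ℝ) - 1) / p) ^ (n - s i)) * invFact ((n : ℤ) - s i))
    (fun j => ct p n (Ex ((Finset.Icc 1 (k + 1)).image s) (s j)) /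
      (Fintype.card (ColoredPerm p n) : ℝ))
    (by intro i _; simp [invFact])
    (by
      intro i j hji hi
      have := hsl i hi.le j hji
      simp only [invFact]
      rw [if_neg (by omega)])
    (by
      intro i hi
      have hs := alt_sum (p := p) (n := n) hmono i (k - i) (by omega)
      have e : i + (k - i) = k := by omega
      rw [e] at hs
      have hB : ct p n (fun σ => Asc (s i) (s (k + 1)) σ ∧
        s (k + 1) ∈ cpD'DescentSet σ ∧
        Ex ((Finset.Icc 1 (k + 1)).image s) (s (k + 1)) σ) =
        ct p n (fun σ => Asc (s i) n σ ∧ n ∈ cpD'DescentSet σ) := by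
        refine ct_congr fun σ => ?_
        rw [hlast]
        have : Ex ((Finset.Icc 1 (k + 1)).image s) n σ := by
          intro m hm
          refine iff_of_false (fun h => ?_) (fun h => ?_)
          · have := D_bound σ h; omega
          · rw [Finset.mem_image] at h
            obtain ⟨j, hj, rfl⟩ := h
            have := hsle j (k + 1) (Finset.mem_Icc.1 hj).2 le_rfl
            omega
        tauto
      rw [hB, b_eq hp (s i) (hlast ▸ hsl (k + 1) le_rfl i hi)] at hs
      rw [← Finset.sum_range_add_sum_Ico _ hi.le, Finset.sum_eq_zero, zero_add]
      · rw [← mul_left_inj' hcard, Finset.sum_mul, mul_assoc, ← hs]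
        refine Finset.sum_congr rfl fun j hj => ?_
        rw [Finset.mem_Ico] at hj
        rw [a_eq _ _ (hsle i j hj.1 hj.2.le) (hlast ▸ hsle j (k + 1) hj.2.le le_rfl)]
        field_simp
      · intro j hj
        rw [Finset.mem_range] at hj
        have := hsl i hi.le j hj
        simp only [invFact]
        rw [if_neg (by omega)]; simp)
  have hE : ct p n (Ex ((Finset.Icc 1 (k + 1)).image s) (s 0)) =
      ((Finset.univ.filter fun σ : ColoredPerm p n =>
        cpD'DescentSet σ = (Finset.Icc 1 (k + 1)).image s).card : ℝ) := by
    have : ct p n (Ex ((Finset.Icc 1 (k + 1)).image s) (s 0)) = ct p n (fun σ =>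
        cpD'DescentSet σ = (Finset.Icc 1 (k + 1)).image s) := by
      refine ct_congr fun σ => ?_
      rw [hs0]
      constructor
      · intro h
        ext m
        rcases Nat.eq_zero_or_pos m with h0 | h0
        · subst h0
          refine iff_of_false (fun h => ?_) (fun h => ?_)
          · have := D_bound σ h; omega
          · rw [Finset.mem_image] at h
            obtain ⟨j, hj, hj0⟩ := h
            rw [Finset.mem_Icc] at hj
            have := hsl j hj.2 0 (by omega)
            omega
        · exact h m h0
      · intro h m _
        rw [h]
    rw [this, ct_eq]
  simp only [Nat.add_sub_cancel]
  rw [← hE]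
  convert hdet using 1
end
end
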